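/- For every integer s ≥ 4 and every odd integer r with 7 ≤ r ≤ 2s - 4, there exists n₀ = n₀(r,s) such that for all n ≥ n₀: every K_s-saturated graph on n vertices contains at least as many copies of C_r (subgraphs isomorphic to the cycle of length r) as the join K_{s-2} ∗ \bar{K}_{n-s+2}, and the only n-vertex K_s-saturated graph attaining this minimum is K_{s-2} ∗ \bar{K}_{n-s+2}. -/

import Mathlib

open SimpleGraph Finset

variable {V : Type*}

/-- The graph `G` with the edge `u v` added. -/
def addEdge (G : SimpleGraph V) (u v : V) : SimpleGraph V :=
  G ⊔ SimpleGraph.fromEdgeSet {s(u, v)}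

/-- `G` is `K_s`-saturated: `G` is `K_s`-free and adding any missing edge creates a `K_s`. -/
def KSat (s : ℕ) (G : SimpleGraph V) : Prop :=
  G.CliqueFree s ∧ ∀ u v : V, u ≠ v → ¬ G.Adj u v → ¬ (addEdge G u v).CliqueFree s

/-- The number of copies of `K_r` in `G`: the number of `r`-sets of vertices inducing
a complete graph. -/
noncomputable def cliqueCount (G : SimpleGraph V) (r : ℕ) : ℕ :=
  {t : Finset V | G.IsNClique r t}.ncard

/-- `sat(n, K_r, K_s)`: minimum number of copies of `K_r` in an `n`-vertex
`K_s`-saturated graph. -/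
noncomputable def satCliques (n r s : ℕ) : ℕ :=
  sInf {m | ∃ G : SimpleGraph (Fin n), KSat s G ∧ cliqueCount G r = m}

/-- The join `K_{s-2} ∗ ∅_{n-s+2}` on `Fin n`. -/
def joinGraph (n s : ℕ) : SimpleGraph (Fin n) :=
  SimpleGraph.fromRel (fun i _ => (i : ℕ) < s - 2)

/-- The number of copies of `C_r` in `G` : the number of subgraphs of `G`
isomorphic to the cycle on `r` vertices. -/
noncomputable def cycleCount (G : SimpleGraph V) (r : ℕ) : ℕ :=
  {H : G.Subgraph | Nonempty (H.coe ≃g cycleGraph r)}.ncard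

/-- `sat(n, C_r, K_s)`. -/
noncomputable def satCyclesCliqueSat (n r s : ℕ) : ℕ :=
  sInf {m | ∃ G : SimpleGraph (Fin n), KSat s G ∧ cycleCount G r = m}

/-- `G` contains a copy of `F`, i.e. a subgraph isomorphic to `F`. -/
def ContainsCopy {α β : Type*} (F : SimpleGraph α) (G : SimpleGraph β) : Prop :=
  ∃ f : α → β, Function.Injective f ∧ ∀ a b : α, F.Adj a b → G.Adj (f a) (f b)

/-- strongly K_s-saturated -/
def StronglyKSat (s : ℕ) (G : SimpleGraph V) : Prop :=
  ∀ u v : V, u ≠ v → ¬ G.Adj u v →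
    ∃ t : Finset V, (addEdge G u v).IsNClique s t ∧ u ∈ t ∧ v ∈ t

/-- dumbbell -/
def dumbbell (m : ℕ) : SimpleGraph (Fin (2 * m)) :=
  SimpleGraph.fromRel (fun i j =>
    ((i : ℕ) < m ∧ (j : ℕ) < m) ∨ (m ≤ (i : ℕ) ∧ m ≤ (j : ℕ)) ∨ ((i : ℕ) = 0 ∧ (j : ℕ) = m))

def Vgraph (m : ℕ) : SimpleGraph (Fin (m + 2)) :=
  SimpleGraph.fromRel (fun i j =>
    ((i : ℕ) < m ∧ (j : ℕ) < m) ∨ ((i : ℕ) = 0 ∧ m ≤ (j : ℕ)))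

def lambdaGraph (m : ℕ) : SimpleGraph (Fin (m + 1)) :=
  SimpleGraph.fromRel (fun i j =>
    ((i : ℕ) < m ∧ (j : ℕ) < m) ∨ ((i : ℕ) = m ∧ (j : ℕ) < 2))

def VgraphGen (m r : ℕ) : SimpleGraph (Fin (m + (m - r))) :=
  SimpleGraph.fromRel (fun i j =>
    ((i : ℕ) < m ∧ (j : ℕ) < m) ∨
      (((i : ℕ) = 0 ∨ m ≤ (i : ℕ)) ∧ ((j : ℕ) = 0 ∨ m ≤ (j : ℕ))))

def lambdaGraphGen (m r : ℕ) : SimpleGraph (Fin (m + 1)) :=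
  SimpleGraph.fromRel (fun i j =>
    ((i : ℕ) < m ∧ (j : ℕ) < m) ∨ ((i : ℕ) = m ∧ (j : ℕ) < r))

/-- `G` is saturated with respect to the family `{F₁, F₂, F₃}`. -/
def FamSat3 {α₁ α₂ α₃ : Type*} (F₁ : SimpleGraph α₁) (F₂ : SimpleGraph α₂)
    (F₃ : SimpleGraph α₃) (G : SimpleGraph V) : Prop :=
  ¬ ContainsCopy F₁ G ∧ ¬ ContainsCopy F₂ G ∧ ¬ ContainsCopy F₃ G ∧
    ∀ u v : V, u ≠ v → ¬ G.Adj u v →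
      ContainsCopy F₁ (addEdge G u v) ∨ ContainsCopy F₂ (addEdge G u v) ∨
        ContainsCopy F₃ (addEdge G u v)

noncomputable def satFam3 {α₁ α₂ α₃ : Type*} (n : ℕ) (F₁ : SimpleGraph α₁)
    (F₂ : SimpleGraph α₂) (F₃ : SimpleGraph α₃) : ℕ :=
  sInf {m | ∃ G : SimpleGraph (Fin n), FamSat3 F₁ F₂ F₃ G ∧ G.edgeSet.ncard = m}

noncomputable def satCliquesFam3 {α₁ α₂ α₃ : Type*} (n r : ℕ) (F₁ : SimpleGraph α₁)
    (F₂ : SimpleGraph α₂) (F₃ : SimpleGraph α₃) : ℕ :=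
  sInf {m | ∃ G : SimpleGraph (Fin n), FamSat3 F₁ F₂ F₃ G ∧ cliqueCount G r = m}

/-- saturation w.r.t. a single graph, with copies as subgraphs. -/
def SatGraph {α : Type*} (F : SimpleGraph α) (G : SimpleGraph V) : Prop :=
  ¬ ContainsCopy F G ∧ ∀ u v : V, u ≠ v → ¬ G.Adj u v → ContainsCopy F (addEdge G u v)

noncomputable def satCyclesGraphSat {α : Type*} (n r : ℕ) (F : SimpleGraph α) : ℕ :=
  sInf {m | ∃ G : SimpleGraph (Fin n), SatGraph F G ∧ cycleCount G r = m}

/-- number of independent sets of size l -/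
noncomputable def indepCount (G : SimpleGraph V) (l : ℕ) : ℕ :=
  {t : Finset V | t.card = l ∧ ∀ a ∈ t, ∀ b ∈ t, ¬ G.Adj a b}.ncard

/-- Ramsey number -/
noncomputable def ramsey (l s : ℕ) : ℕ :=
  sInf {N | ∀ G : SimpleGraph (Fin N),
    (∃ t : Finset (Fin N), t.card = l ∧ ∀ a ∈ t, ∀ b ∈ t, ¬ G.Adj a b) ∨
      ∃ t : Finset (Fin N), G.IsNClique s t}

section DistinctRepresentatives

/-- A family of large sets has a system of distinct representatives avoiding a small set. -/
lemma exists_injective_mem_notMem [DecidableEq V] {N : ℕ} (S : Fin N → Finset V) (Z : Finset V)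
    (h : ∀ i, #Z + N ≤ #(S i)) :
    ∃ t : Fin N → V, Function.Injective t ∧ (∀ i, t i ∈ S i) ∧ ∀ i, t i ∉ Z := by
  obtain ⟨t, ht, ht'⟩ :=
    (Finset.all_card_le_biUnion_card_iff_exists_injective (fun i => S i \ Z)).1 (by
      intro s
      obtain rfl | ⟨i, hi⟩ := s.eq_empty_or_nonempty
      · simp
      have h1 : #(S i \ Z) ≤ #(s.biUnion fun i => S i \ Z) :=
        card_le_card (subset_biUnion_of_mem (fun i => S i \ Z) hi)
      have h2 := le_card_sdiff Z (S i)
      have h3 : #s ≤ N := by simpa using card_le_univ s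
      have h4 := h i
      omega)
  exact ⟨t, ht, fun i => (mem_sdiff.1 (ht' i)).1, fun i => (mem_sdiff.1 (ht' i)).2⟩

open Classical in
/-- The systems of distinct representatives of a family of finite sets. -/
noncomputable def sdrs {N : ℕ} (S : Fin N → Finset V) : Finset (Fin N → V) :=
  {t ∈ Fintype.piFinset S | Function.Injective t}

lemma mem_sdrs {N : ℕ} {S : Fin N → Finset V} {t : Fin N → V} :
    t ∈ sdrs S ↔ (∀ i, t i ∈ S i) ∧ Function.Injective t := by
  simp [sdrs]

open Classical in
lemma card_sdrs_succ {N : ℕ} (S : Fin (N + 1) → Finset V) :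
    #(sdrs S) = ∑ x ∈ S 0, #(sdrs fun i : Fin N => (S i.succ).erase x) := by
  rw [← card_sigma]
  symm
  refine card_bij (fun y _ => Fin.cons y.1 y.2) ?_ ?_ ?_
  · rintro ⟨x, t⟩ h
    simp only [mem_sigma, mem_sdrs, mem_erase] at h ⊢
    refine ⟨fun i => ?_, ?_⟩
    · refine Fin.cases ?_ (fun i => ?_) i
      · simpa using h.1
      · simpa using (h.2.1 i).2
    · rw [Fin.cons_injective_iff]
      refine ⟨?_, h.2.2⟩
      rintro ⟨i, hi⟩
      exact (h.2.1 i).1 hi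
  · rintro ⟨x, t⟩ _ ⟨x', t'⟩ _ h
    have := Fin.cons_inj.1 h
    simp_all
  · intro t ht
    rw [mem_sdrs] at ht
    refine ⟨⟨t 0, Fin.tail t⟩, ?_, Fin.cons_self_tail t⟩
    simp only [mem_sigma, mem_sdrs, mem_erase]
    exact ⟨ht.1 0, fun i => ⟨fun h => Fin.succ_ne_zero i (ht.2 h), ht.1 _⟩,
      ht.2.comp (Fin.succ_injective _)⟩

lemma prod_le_card_sdrs {N : ℕ} (S : Fin N → Finset V) (a : Fin N → ℕ)
    (h : ∀ i, a i + i ≤ #(S i)) : ∏ i, a i ≤ #(sdrs S) := by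
  classical
  induction N with
  | zero =>
    have : sdrs S = {Fin.elim0} := by
      ext t
      simp only [mem_sdrs, mem_singleton]
      exact ⟨fun _ => Subsingleton.elim _ _, fun _ => ⟨fun i => i.elim0, fun i => i.elim0⟩⟩
    simp [this]
  | succ N ih =>
    rw [card_sdrs_succ, Fin.prod_univ_succ]
    have h0 : a 0 ≤ #(S 0) := by simpa using h 0
    calc a 0 * ∏ i : Fin N, a i.succ ≤ #(S 0) * ∏ i : Fin N, a i.succ :=
          Nat.mul_le_mul_right _ h0
      _ ≤ _ := by
          rw [← smul_eq_mul]
          refine card_nsmul_le_sum _ _ _ fun x _ => ih _ _ fun i => ?_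
          have h1 := h i.succ
          have h2 := pred_card_le_card_erase (s := S i.succ) (a := x)
          simp only [Fin.val_succ] at h1
          omega

lemma descFactorial_eq_prod_fin (p N : ℕ) : p.descFactorial N = ∏ i : Fin N, (p - i) := by
  rw [Nat.descFactorial_eq_prod_range, Finset.prod_range]

lemma descFactorial_le_card_sdrs {N p : ℕ} (S : Fin N → Finset V) (hN : N ≤ p)
    (h : ∀ i, p ≤ #(S i)) : p.descFactorial N ≤ #(sdrs S) := by
  rw [descFactorial_eq_prod_fin]
  refine prod_le_card_sdrs S _ fun i => ?_
  have := h i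
  have := i.2
  omega

lemma card_sdrs_const (N : ℕ) (T : Finset V) :
    #(sdrs fun _ : Fin N => T) = (#T).descFactorial N := by
  classical
  induction N generalizing T with
  | zero =>
    have : sdrs (fun _ : Fin 0 => T) = {Fin.elim0} := by
      ext t
      simp only [mem_sdrs, mem_singleton]
      exact ⟨fun _ => Subsingleton.elim _ _, fun _ => ⟨fun i => i.elim0, fun i => i.elim0⟩⟩
    simp [this]
  | succ N ih =>
    rw [card_sdrs_succ, Finset.sum_congr rfl fun x hx => by rw [ih, card_erase_of_mem hx],
      sum_const, smul_eq_mul]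
    obtain h | h := (#T).eq_zero_or_pos
    · simp [h]
    · obtain ⟨m, hm⟩ := Nat.exists_eq_succ_of_ne_zero h.ne'
      rw [hm, Nat.succ_descFactorial_succ]
      rfl

lemma descFactorial_lt_card_sdrs {N p : ℕ} (S : Fin (N + 2) → Finset V) (hN : N + 2 ≤ p)
    (h : ∀ i, p ≤ #(S i)) {x : V} (hx : x ∈ S 0) (hx' : x ∉ S 1) :
    p.descFactorial (N + 2) < #(sdrs S) := by
  classical
  have hprod : p.descFactorial (N + 2) = p * ∏ i : Fin (N + 1), (p - (i + 1)) := by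
    rw [descFactorial_eq_prod_fin, Fin.prod_univ_succ]
    simp
  have hlow : ∀ y, ∏ i : Fin (N + 1), (p - (i + 1)) ≤
      #(sdrs fun i : Fin (N + 1) => (S i.succ).erase y) := fun y => by
    refine prod_le_card_sdrs _ _ fun i => ?_
    have h1 := h i.succ
    have h2 := pred_card_le_card_erase (s := S i.succ) (a := y)
    have := i.2
    omega
  have hstrict : ∏ i : Fin (N + 1), (p - (i + 1)) <
      #(sdrs fun i : Fin (N + 1) => (S i.succ).erase x) := by
    have h3 : ∏ i : Fin (N + 1), (if i = 0 then p else p - (i + 1)) ≤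
        #(sdrs fun i : Fin (N + 1) => (S i.succ).erase x) := by
      refine prod_le_card_sdrs _ _ fun i => ?_
      refine Fin.cases ?_ (fun i => ?_) i
      · have h1 := h 1
        have h4 : ((S 1).erase x) = S 1 := erase_eq_of_notMem hx'
        simpa [h4] using h1
      · have h1 := h i.succ.succ
        have h2 := pred_card_le_card_erase (s := S i.succ.succ) (a := x)
        have := i.2
        simp only [Fin.succ_ne_zero, if_false, Fin.val_succ]
        omega
    refine lt_of_lt_of_le ?_ h3
    rw [Fin.prod_univ_succ, Fin.prod_univ_succ]
    simp only [Fin.succ_ne_zero, if_true, if_false, Fin.val_zero, Fin.val_succ]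
    refine Nat.mul_lt_mul_of_pos_right (by omega) (Finset.prod_pos fun i _ => ?_)
    have := i.2
    omega
  rw [hprod, card_sdrs_succ]
  calc p * ∏ i : Fin (N + 1), (p - (i + 1)) ≤ #(S 0) * ∏ i : Fin (N + 1), (p - (i + 1)) :=
        Nat.mul_le_mul_right _ (h 0)
    _ = ∑ _x ∈ S 0, ∏ i : Fin (N + 1), (p - (i + 1)) := by rw [sum_const, smul_eq_mul]
    _ < _ := sum_lt_sum (fun y _ => hlow y) ⟨x, hx, hstrict⟩

end DistinctRepresentatives

section LabelledCycles

open Classical in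
/-- The labelled cycles of length `2 * k + 1` in `G`. -/
noncomputable def oddCycles [Fintype V] (G : SimpleGraph V) (k : ℕ) :
    Finset (Fin (2 * k + 1) → V) :=
  {f | Function.Injective f ∧ ∀ j, G.Adj (f j) (f (j + 1))}

lemma mem_oddCycles [Fintype V] {G : SimpleGraph V} {k : ℕ} {f : Fin (2 * k + 1) → V} :
    f ∈ oddCycles G k ↔ Function.Injective f ∧ ∀ j, G.Adj (f j) (f (j + 1)) := by
  simp [oddCycles]

/-- The position `2 * i` of a cycle of length `2 * k + 1`. -/
def evenPos {k : ℕ} (i : Fin k) : Fin (2 * k + 1) := ⟨2 * i, by omega⟩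

/-- The positions `1, 3, …, 2 * k - 1` and `2 * k` of a cycle of length `2 * k + 1`. -/
def oddPos {k : ℕ} (i : Fin (k + 1)) : Fin (2 * k + 1) :=
  ⟨if (i : ℕ) < k then 2 * i + 1 else 2 * k, by split_ifs <;> omega⟩

/-- The sequence `b 0, t 0, b 1, t 1, …, b (k - 1), t (k - 1), t k`. -/
def weave {k : ℕ} (b : Fin k → V) (t : Fin (k + 1) → V) (j : Fin (2 * k + 1)) : V :=
  if h : (j : ℕ) % 2 = 0 ∧ (j : ℕ) < 2 * k then b ⟨j / 2, by omega⟩ else t ⟨j / 2, by omega⟩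

lemma weave_evenPos {k : ℕ} (b : Fin k → V) (t : Fin (k + 1) → V) (i : Fin k) :
    weave b t (evenPos i) = b i := by
  unfold weave evenPos
  rw [dif_pos (by dsimp only; omega)]
  congr
  dsimp only
  omega

lemma weave_oddPos {k : ℕ} (b : Fin k → V) (t : Fin (k + 1) → V) (i : Fin (k + 1)) :
    weave b t (oddPos i) = t i := by
  unfold weave oddPos
  rw [dif_neg (by dsimp only; split_ifs <;> omega)]
  congr
  dsimp only
  split_ifs <;> omega

lemma evenPos_or_oddPos {k : ℕ} (j : Fin (2 * k + 1)) :
    (∃ i, j = evenPos i) ∨ ∃ i, j = oddPos i := by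
  by_cases h : (j : ℕ) % 2 = 0 ∧ (j : ℕ) < 2 * k
  · exact Or.inl ⟨⟨j / 2, by omega⟩, Fin.ext (by simp only [evenPos]; omega)⟩
  · exact Or.inr ⟨⟨j / 2, by omega⟩, Fin.ext (by simp only [oddPos]; split_ifs <;> omega)⟩

lemma oddPos_injective {k : ℕ} : Function.Injective (oddPos (k := k)) := by
  intro i j h
  simp only [oddPos, Fin.mk.injEq] at h
  split_ifs at h <;> omega

lemma fin_val_add_one {m : ℕ} (j : Fin (m + 1)) :
    ((j + 1 : Fin (m + 1)) : ℕ) = if (j : ℕ) < m then (j : ℕ) + 1 else 0 := by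
  rw [Fin.val_add_one]
  have := j.2
  simp only [Fin.ext_iff, Fin.val_last]
  split_ifs <;> omega

lemma evenPos_add_one {k : ℕ} (i : Fin k) : evenPos i + 1 = oddPos i.castSucc := by
  ext
  rw [fin_val_add_one]
  have := i.2
  rw [if_pos (by simp only [evenPos]; omega)]
  simp [evenPos, oddPos]

lemma oddPos_add_one {k : ℕ} {i : Fin (k + 1)} (hi : (i : ℕ) + 1 < k) :
    oddPos i + 1 = evenPos ⟨i + 1, hi⟩ := by
  ext
  rw [fin_val_add_one]
  simp only [evenPos, oddPos]
  split_ifs <;> omega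

lemma oddPos_pred_last_add_one {k : ℕ} {i : Fin (k + 1)} (hi : (i : ℕ) + 1 = k) :
    oddPos i + 1 = oddPos (Fin.last k) := by
  ext
  rw [fin_val_add_one]
  simp only [oddPos, Fin.val_last]
  split_ifs <;> omega

lemma oddPos_last_add_one {k : ℕ} (hk : 0 < k) :
    oddPos (Fin.last k) + 1 = evenPos ⟨0, hk⟩ := by
  ext
  rw [fin_val_add_one]
  simp only [evenPos, oddPos, Fin.val_last]
  split_ifs <;> omega

lemma weave_mem_oddCycles [Fintype V] {G : SimpleGraph V} {k : ℕ} (hk : 0 < k) {b : Fin k → V}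
    {t : Fin (k + 1) → V} (hb : Function.Injective b) (ht : Function.Injective t)
    (hbt : ∀ i j, b i ≠ t j)
    (h₁ : ∀ i (hi : i < k), G.Adj (b ⟨i, hi⟩) (t ⟨i, by omega⟩))
    (h₂ : ∀ i (hi : i + 1 < k), G.Adj (t ⟨i, by omega⟩) (b ⟨i + 1, hi⟩))
    (h₃ : G.Adj (t ⟨k - 1, by omega⟩) (t (Fin.last k)))
    (h₄ : G.Adj (t (Fin.last k)) (b ⟨0, hk⟩)) :
    weave b t ∈ oddCycles G k := by
  rw [mem_oddCycles]
  constructor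
  · intro x y hxy
    rcases evenPos_or_oddPos x with ⟨i, rfl⟩ | ⟨i, rfl⟩ <;>
    rcases evenPos_or_oddPos y with ⟨j, rfl⟩ | ⟨j, rfl⟩ <;>
    simp only [weave_evenPos, weave_oddPos] at hxy
    · rw [hb hxy]
    · exact absurd hxy (hbt _ _)
    · exact absurd hxy.symm (hbt _ _)
    · rw [ht hxy]
  · intro j
    rcases evenPos_or_oddPos j with ⟨i, rfl⟩ | ⟨i, rfl⟩
    · rw [evenPos_add_one, weave_evenPos, weave_oddPos]
      exact h₁ i i.2
    · obtain hi | hi := (Nat.le_of_lt_succ i.2).lt_or_eq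
      · obtain hi' | hi' := (Nat.succ_le_of_lt hi).lt_or_eq
        · rw [oddPos_add_one hi', weave_evenPos, weave_oddPos]
          exact h₂ i hi'
        · rw [oddPos_pred_last_add_one hi', weave_oddPos, weave_oddPos]
          convert h₃
          simp only [Nat.succ_eq_add_one] at hi'
          omega
      · have hl : i = Fin.last k := Fin.ext hi
        rw [hl, oddPos_last_add_one hk, weave_evenPos, weave_oddPos]
        exact h₄

/-- Any two distinct nonadjacent vertices have a `p`-clique in their common neighbourhood. -/
def CommonCliques (p : ℕ) (G : SimpleGraph V) : Prop :=
  ∀ u v, u ≠ v → ¬ G.Adj u v →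
    ∃ S : Finset V, G.IsNClique p S ∧ ∀ t ∈ S, G.Adj u t ∧ G.Adj v t

lemma KSat.commonCliques {s : ℕ} {G : SimpleGraph V} (h : KSat s G) :
    CommonCliques (s - 2) G := by
  classical
  intro u v huv hadj
  have h1 := h.2 u v huv hadj
  simp only [SimpleGraph.CliqueFree, not_forall, not_not] at h1
  obtain ⟨Q, hQ⟩ := h1
  have hA : ∀ a b, (addEdge G u v).Adj a b ↔
      G.Adj a b ∨ (a = u ∧ b = v ∨ a = v ∧ b = u) ∧ a ≠ b := by
    intro a b
    simp [addEdge]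
  have hcl : ∀ a ∈ Q, ∀ b ∈ Q, a ≠ b → (addEdge G u v).Adj a b :=
    fun a ha b hb hab => hQ.1 (by simpa using ha) (by simpa using hb) hab
  have hu : u ∈ Q := by
    by_contra hu
    refine h.1 Q ⟨fun a ha b hb hab => ?_, hQ.2⟩
    have ha' : a ∈ Q := by simpa using ha
    have hb' : b ∈ Q := by simpa using hb
    rcases (hA a b).1 (hcl a ha' b hb' hab) with h2 | ⟨⟨rfl, rfl⟩ | ⟨rfl, rfl⟩, -⟩
    · exact h2
    · contradiction
    · contradiction
  have hv : v ∈ Q := by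
    by_contra hv
    refine h.1 Q ⟨fun a ha b hb hab => ?_, hQ.2⟩
    have ha' : a ∈ Q := by simpa using ha
    have hb' : b ∈ Q := by simpa using hb
    rcases (hA a b).1 (hcl a ha' b hb' hab) with h2 | ⟨⟨rfl, rfl⟩ | ⟨rfl, rfl⟩, -⟩
    · exact h2
    · contradiction
    · contradiction
  refine ⟨(Q.erase u).erase v, ⟨fun a ha b hb hab => ?_, ?_⟩, fun t ht => ?_⟩
  · simp only [coe_erase, Set.mem_sdiff, mem_coe, Set.mem_singleton_iff] at ha hb
    have := (hA a b).1 (hcl a ha.1.1 b hb.1.1 hab)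
    aesop
  · rw [card_erase_of_mem (by simp [hv, huv.symm]), card_erase_of_mem hu, hQ.2]
    omega
  · simp only [mem_erase] at ht
    have h2 := (hA u t).1 (hcl u hu t ht.2.2 (Ne.symm ht.2.1))
    have h3 := (hA v t).1 (hcl v hv t ht.2.2 (Ne.symm ht.1))
    aesop

/-- The tuple `b` enumerates an independent set of `G`. -/
def IndepTuple {k : ℕ} (G : SimpleGraph V) (b : Fin k → V) : Prop :=
  Function.Injective b ∧ ∀ i j, ¬ G.Adj (b i) (b j)

/-- An independent tuple whose first two entries have the common neighbour `z` extends to a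
labelled cycle with `z` between these two entries. -/
lemma IndepTuple.exists_oddCycle_one [Fintype V] {G : SimpleGraph V} {p k : ℕ}
    (hG : CommonCliques p G) (hkp : k + 1 ≤ p) (hk : 2 ≤ k) {b : Fin k → V}
    (hb : IndepTuple G b) {z : V} (h₀ : G.Adj z (b ⟨0, by omega⟩))
    (h₁ : G.Adj z (b ⟨1, by omega⟩)) :
    ∃ f ∈ oddCycles G k, (∀ i, f (evenPos i) = b i) ∧
      f (oddPos ⟨0, by omega⟩) = z := by
  classical
  have key : ∀ u v : Fin k, u ≠ v → ∃ S : Finset V, G.IsNClique p S ∧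
      ∀ t ∈ S, G.Adj (b u) t ∧ G.Adj (b v) t :=
    fun u v huv => hG _ _ (fun h => huv (hb.1 h)) (hb.2 _ _)
  choose! S hS hS' using key
  -- `w i` is the gap served by the representative number `i`
  let w : Fin k → Fin k × Fin k := fun i =>
    if h : (i : ℕ) + 2 < k then (⟨i + 1, by omega⟩, ⟨i + 2, h⟩)
    else (⟨k - 1, by omega⟩, ⟨0, by omega⟩)
  have hw : ∀ i, (w i).1 ≠ (w i).2 := by
    intro i
    simp only [w]
    split_ifs <;> simp [Fin.ext_iff]
    omega
  obtain ⟨t, ht, htS, htZ⟩ := exists_injective_mem_notMem (fun i => S (w i).1 (w i).2) {z}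
    (fun i => by rw [(hS _ _ (hw i)).2, card_singleton]; omega)
  have hadj₁ : ∀ i, G.Adj (b (w i).1) (t i) := fun i => (hS' _ _ (hw i) _ (htS i)).1
  have hadj₂ : ∀ i, G.Adj (b (w i).2) (t i) := fun i => (hS' _ _ (hw i) _ (htS i)).2
  have htz : ∀ i, t i ≠ z := fun i h => htZ i (by simp [h])
  refine ⟨weave b (Fin.cons z t : Fin (k + 1) → V), ?_, fun i => weave_evenPos _ _ _, ?_⟩
  swap
  · rw [weave_oddPos]
    rfl
  refine weave_mem_oddCycles (by omega) hb.1 ?_ ?_ ?_ ?_ ?_ ?_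
  · rw [Fin.cons_injective_iff]
    exact ⟨fun ⟨i, hi⟩ => htz i hi, ht⟩
  · intro i j
    refine Fin.cases ?_ (fun j => ?_) j
    · rintro h
      rw [Fin.cons_zero] at h
      exact hb.2 _ _ (h ▸ h₀)
    · rintro h
      rw [Fin.cons_succ] at h
      exact hb.2 _ _ (h ▸ hadj₁ j)
  · intro i hi
    obtain _ | i := i
    · exact h₀.symm
    · change G.Adj _ (t ⟨i, by omega⟩)
      by_cases h : i + 2 < k
      · have := hadj₁ ⟨i, by omega⟩
        simpa [w, h] using this
      · have h5 := hadj₁ ⟨i, by omega⟩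
        simp only [w, h, dite_false] at h5
        convert h5 using 3
        omega
  · intro i hi
    obtain _ | i := i
    · exact h₁
    · change G.Adj (t ⟨i, by omega⟩) _
      have := hadj₂ ⟨i, by omega⟩
      simp only [w, show i + 2 < k by omega, dite_true] at this
      exact this.symm
  · have e1 : (⟨k - 1, by omega⟩ : Fin (k + 1)) = Fin.succ ⟨k - 2, by omega⟩ := by
      ext
      simp only [Fin.val_succ]
      omega
    have e2 : Fin.last k = Fin.succ (⟨k - 1, by omega⟩ : Fin k) := by
      ext
      simp only [Fin.val_succ, Fin.val_last]
      omega
    rw [e1, e2, Fin.cons_succ, Fin.cons_succ]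
    have hc := (hS ⟨k - 1, by omega⟩ ⟨0, by omega⟩ (by simp [Fin.ext_iff]; omega)).1
    refine hc ?_ ?_ (fun h => ?_)
    · have := htS ⟨k - 2, by omega⟩
      simpa [w, show ¬ (k - 2 + 2 < k) by omega] using this
    · have := htS ⟨k - 1, by omega⟩
      simpa [w, show ¬ (k - 1 + 2 < k) by omega] using this
    · have := ht h
      simp only [Fin.mk.injEq] at this
      omega
  · have e2 : Fin.last k = Fin.succ (⟨k - 1, by omega⟩ : Fin k) := by
      ext
      simp only [Fin.val_succ, Fin.val_last]
      omega
    rw [e2, Fin.cons_succ]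
    have := hadj₂ ⟨k - 1, by omega⟩
    simp only [w, show ¬ (k - 1 + 2 < k) by omega, dite_false] at this
    exact this.symm

/-- An independent tuple and a neighbour `z` of its first entry which is not adjacent to its last
entry extend to a labelled cycle with `z` in the last position. -/
lemma IndepTuple.exists_oddCycle_last [Fintype V] {G : SimpleGraph V} {p k : ℕ}
    (hG : CommonCliques p G) (hkp : k + 1 ≤ p) (hk : 2 ≤ k) {b : Fin k → V}
    (hb : IndepTuple G b) {z : V} (h₀ : G.Adj z (b ⟨0, by omega⟩))
    (h₁ : ¬ G.Adj z (b ⟨k - 1, by omega⟩)) :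
    ∃ f ∈ oddCycles G k, (∀ i, f (evenPos i) = b i) ∧ f (oddPos (Fin.last k)) = z := by
  classical
  have hzb : ∀ i, b i ≠ z := by
    rintro i rfl
    exact hb.2 _ _ h₀
  let c : Fin k → V := fun i => if h : (i : ℕ) + 1 < k then b ⟨i + 1, h⟩ else z
  have key : ∀ i : Fin k, ∃ S : Finset V, G.IsNClique p S ∧
      ∀ t ∈ S, G.Adj (b i) t ∧ G.Adj (c i) t := by
    intro i
    refine hG _ _ ?_ ?_
    · simp only [c]
      split_ifs with h
      · intro h'
        have := hb.1 h'
        simp [Fin.ext_iff] at this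
      · exact hzb i
    · simp only [c]
      split_ifs with h
      · exact hb.2 _ _
      · have e : i = ⟨k - 1, by omega⟩ := by
          ext
          simp only
          omega
        rw [e]
        exact fun h' => h₁ h'.symm
  choose S hS hS' using key
  obtain ⟨t, ht, htS, htZ⟩ := exists_injective_mem_notMem S {z}
    (fun i => by rw [(hS i).2, card_singleton]; omega)
  have hadj₁ : ∀ i, G.Adj (b i) (t i) := fun i => (hS' _ _ (htS i)).1
  have hadj₂ : ∀ i, G.Adj (c i) (t i) := fun i => (hS' _ _ (htS i)).2
  have htz : ∀ i, t i ≠ z := fun i h => htZ i (by simp [h])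
  have hsnoc : ∀ i (hi : i < k), (Fin.snoc t z : Fin (k + 1) → V) ⟨i, by omega⟩ = t ⟨i, hi⟩ :=
    fun i hi => Fin.snoc_castSucc (α := fun _ => V) z t ⟨i, hi⟩
  have hsnoc' : (Fin.snoc t z : Fin (k + 1) → V) (Fin.last k) = z :=
    Fin.snoc_last (α := fun _ => V) z t
  refine ⟨weave b (Fin.snoc t z : Fin (k + 1) → V), ?_, fun i => weave_evenPos _ _ _, ?_⟩
  swap
  · rw [weave_oddPos, hsnoc']
  refine weave_mem_oddCycles (by omega) hb.1 ?_ ?_ ?_ ?_ ?_ ?_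
  · rw [Fin.snoc_injective_iff]
    exact ⟨ht, fun ⟨i, hi⟩ => htz i hi⟩
  · intro i j
    refine Fin.lastCases ?_ (fun j => ?_) j
    · rw [hsnoc']
      exact hzb i
    · rw [Fin.snoc_castSucc]
      intro h
      exact hb.2 _ _ (h ▸ hadj₁ j)
  · intro i hi
    rw [hsnoc i hi]
    exact hadj₁ _
  · intro i hi
    rw [hsnoc i (by omega)]
    have := hadj₂ ⟨i, by omega⟩
    simp only [c, hi, dite_true] at this
    exact this.symm
  · rw [hsnoc _ (by omega), hsnoc']
    have := hadj₂ ⟨k - 1, by omega⟩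
    simp only [c, show ¬ (k - 1 + 1 < k) by omega, dite_false] at this
    exact this.symm
  · rw [hsnoc']
    exact h₀

end LabelledCycles

section IndependentTuples

/-- Ramsey's theorem for a clique and an independent set. -/
lemma exists_indep_of_no_clique (s k : ℕ) : ∃ N : ℕ, ∀ (V : Type) (G : SimpleGraph V)
    (A : Finset V), N ≤ #A → (∀ Q ⊆ A, ¬ G.IsNClique s Q) →
    ∃ I ⊆ A, #I = k ∧ ∀ a ∈ I, ∀ b ∈ I, ¬ G.Adj a b := by
  classical
  induction s generalizing k with
  | zero => exact ⟨0, fun V G A _ h => absurd (by simp) (h ∅ (empty_subset _))⟩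
  | succ s ihs =>
    induction k with
    | zero => exact ⟨0, fun V G A _ _ => ⟨∅, by simp⟩⟩
    | succ k ihk =>
      obtain ⟨N₁, hN₁⟩ := ihs (k + 1)
      obtain ⟨N₂, hN₂⟩ := ihk
      refine ⟨N₁ + N₂ + 1, fun V G A hA hQ => ?_⟩
      obtain ⟨a, ha⟩ : A.Nonempty := card_pos.1 (by omega)
      have hsplit := card_filter_add_card_filter_not (s := A.erase a) (fun b => G.Adj a b)
      rw [card_erase_of_mem ha] at hsplit
      obtain h | h : N₁ ≤ #{b ∈ A.erase a | G.Adj a b} ∨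
          N₂ ≤ #{b ∈ A.erase a | ¬ G.Adj a b} := by omega
      · obtain ⟨I, hI, hI'⟩ := hN₁ V G _ h (fun Q hQA hQc => by
          refine hQ (insert a Q) (insert_subset ha fun x hx => ?_) (hQc.insert fun b hb => ?_)
          · exact mem_of_mem_erase (mem_filter.1 (hQA hx)).1
          · exact (mem_filter.1 (hQA hb)).2)
        exact ⟨I, fun x hx => mem_of_mem_erase (mem_filter.1 (hI hx)).1, hI'⟩
      · obtain ⟨I, hI, hIk, hI'⟩ := hN₂ V G _ h (fun Q hQA => hQ Q fun x hx =>
          mem_of_mem_erase (mem_filter.1 (hQA hx)).1)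
        have haI : a ∉ I := fun h => by simpa using hI h
        refine ⟨insert a I, insert_subset ha fun x hx => mem_of_mem_erase
          (mem_filter.1 (hI hx)).1, by rw [card_insert_of_notMem haI, hIk], ?_⟩
        have hna : ∀ x ∈ I, ¬ G.Adj a x := fun x hx => (mem_filter.1 (hI hx)).2
        intro x hx y hy
        rw [mem_insert] at hx hy
        rcases hx with rfl | hx <;> rcases hy with rfl | hy
        · exact G.irrefl
        · exact hna y hy
        · exact fun h => hna x hx h.symm
        · exact hI' x hx y hy

open Classical in
/-- The independent `k`-tuples with entries in `M`. -/
noncomputable def indepTuples (G : SimpleGraph V) (k : ℕ) (M : Finset V) : Finset (Fin k → V) :=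
  {b ∈ Fintype.piFinset fun _ => M | IndepTuple G b}

lemma mem_indepTuples {G : SimpleGraph V} {k : ℕ} {M : Finset V} {b : Fin k → V} :
    b ∈ indepTuples G k M ↔ (∀ i, b i ∈ M) ∧ IndepTuple G b := by
  simp [indepTuples]

open Classical in
lemma card_not_injective_le (k : ℕ) (M : Finset V) :
    #{b ∈ Fintype.piFinset fun _ : Fin (k + 1) => M | ¬ Function.Injective b} ≤
      (k + 1) ^ 2 * #M ^ k := by
  have hsub : {b ∈ Fintype.piFinset fun _ : Fin (k + 1) => M | ¬ Function.Injective b} ⊆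
      (univ.filter fun q : Fin (k + 1) × Fin (k + 1) => q.1 ≠ q.2).biUnion fun q =>
        {b ∈ Fintype.piFinset fun _ : Fin (k + 1) => M | b q.1 = b q.2} := by
    intro b hb
    simp only [mem_filter, Function.Injective, not_forall] at hb
    obtain ⟨hb, i, j, hij, hne⟩ := hb
    simp only [mem_biUnion, mem_filter, mem_univ, true_and, Prod.exists]
    exact ⟨i, j, hne, hb, hij⟩
  refine (card_le_card hsub).trans (card_biUnion_le.trans ?_)
  calc _ ≤ ∑ _q : Fin (k + 1) × Fin (k + 1) with _q.1 ≠ _q.2, #M ^ k := by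
        refine sum_le_sum fun q hq => ?_
        have hq' : q.1 ≠ q.2 := (mem_filter.1 hq).2
        have : #M ^ k = #(Fintype.piFinset fun _ : Fin k => M) := by simp
        rw [this]
        refine card_le_card_of_injOn (fun b i => b (q.2.succAbove i)) ?_ ?_
        · intro b hb
          simp only [coe_filter, Set.mem_ofPred_eq, Fintype.mem_piFinset, mem_coe] at hb ⊢
          exact fun i => hb.1 _
        · intro b hb b' hb' h
          simp only [coe_filter, Set.mem_ofPred_eq] at hb hb'
          have key : ∀ i, i ≠ q.2 → b i = b' i := fun i hi => by
            obtain ⟨j, rfl⟩ := Fin.exists_succAbove_eq hi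
            exact congrFun h j
          funext i
          by_cases hi : i = q.2
          · rw [hi, ← hb.2, ← hb'.2]
            exact key _ hq'
          · exact key i hi
    _ ≤ _ := by
        rw [sum_const, smul_eq_mul]
        refine Nat.mul_le_mul_right _ ((card_filter_le _ _).trans ?_)
        simp [sq]

lemma card_piFinset_comp_eq {k N : ℕ} [DecidableEq V] (M : Finset V) (φ : Fin k ↪ Fin N)
    (b : Fin k → V) :
    #{g ∈ Fintype.piFinset fun _ : Fin N => M | (fun i => g (φ i)) = b} ≤ #M ^ (N - k) := by
  classical
  have hsub : {g ∈ Fintype.piFinset fun _ : Fin N => M | (fun i => g (φ i)) = b} ⊆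
      Fintype.piFinset fun i => if h : ∃ j, φ j = i then {b h.choose} else M := by
    intro g hg
    simp only [mem_filter, Fintype.mem_piFinset] at hg ⊢
    intro i
    split_ifs with h
    · rw [mem_singleton, ← hg.2]
      simp only [h.choose_spec]
    · exact hg.1 i
  refine (card_le_card hsub).trans (le_of_eq ?_)
  rw [Fintype.card_piFinset]
  have : ∀ i, #(if h : ∃ j, φ j = i then {b h.choose} else M) =
      if i ∈ univ.map φ then 1 else #M := by
    intro i
    by_cases h : ∃ j, φ j = i <;> simp [h]
  simp only [this]
  rw [prod_ite, prod_const_one, one_mul, prod_const, filter_not, filter_mem_eq_inter,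
    card_sdiff]
  simp

/-- A positive proportion of the tuples of a clique-free graph is independent. -/
lemma exists_pow_le_mul_card_indepTuples (s k : ℕ) : ∃ K m₀ : ℕ, ∀ {V : Type}
    (G : SimpleGraph V) (M : Finset V), G.CliqueFree s → m₀ ≤ #M →
    #M ^ k ≤ K * #(indepTuples G k M) := by
  classical
  obtain _ | k := k
  · refine ⟨1, 0, fun G M _ _ => ?_⟩
    have : Fin.elim0 ∈ indepTuples G 0 M := by
      simp [mem_indepTuples, IndepTuple, Function.Injective]
    simpa using card_pos.2 ⟨_, this⟩
  obtain ⟨N, hN⟩ := exists_indep_of_no_clique s (k + 1)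
  set E := Fintype.card (Fin (k + 1) ↪ Fin N) with hE
  refine ⟨2 * E, 2 * E * (k + 1) ^ 2 + 1, fun {V} G M hG hM => ?_⟩
  set m := #M
  have hm : 0 < m := by omega
  set W : Finset (Fin (k + 1) → V) :=
    {b ∈ Fintype.piFinset fun _ => M | ∀ i j, ¬ G.Adj (b i) (b j)} with hW
  have hcover : Fintype.piFinset (fun _ : Fin N => M) ⊆
      (univ : Finset (Fin (k + 1) ↪ Fin N)).biUnion fun φ => W.biUnion fun b =>
        {g ∈ Fintype.piFinset fun _ : Fin N => M | (fun i => g (φ i)) = b} := by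
    intro g hg
    obtain ⟨I, -, hI, hI'⟩ := hN (Fin N) (G.comap g) univ (by simp) (fun Q _ hQ => by
      have hinj : Set.InjOn g Q := by
        intro x hx y hy hxy
        by_contra hne
        have := hQ.1 hx hy hne
        rw [SimpleGraph.comap_adj, hxy] at this
        exact G.irrefl this
      refine hG (Q.image g) ⟨?_, by rw [card_image_of_injOn hinj, hQ.2]⟩
      intro x hx y hy hxy
      simp only [coe_image, Set.mem_image, mem_coe] at hx hy
      obtain ⟨x, hx, rfl⟩ := hx
      obtain ⟨y, hy, rfl⟩ := hy
      exact hQ.1 hx hy (fun h => hxy (by rw [h])))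
    let φ : Fin (k + 1) ↪ Fin N := (I.orderEmbOfFin hI).toEmbedding
    have hφ : ∀ i, φ i ∈ I := fun i => I.orderEmbOfFin_mem hI i
    simp only [mem_biUnion, mem_univ, true_and, mem_filter]
    refine ⟨φ, fun i => g (φ i), ?_, hg, rfl⟩
    simp only [hW, mem_filter, Fintype.mem_piFinset] at hg ⊢
    exact ⟨fun i => hg _, fun i j => hI' _ (hφ i) _ (hφ j)⟩
  have h1 : m ^ N ≤ E * (#W * m ^ (N - (k + 1))) := by
    calc m ^ N = #(Fintype.piFinset (fun _ : Fin N => M)) := by simp [m]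
      _ ≤ _ := card_le_card hcover
      _ ≤ ∑ _φ : Fin (k + 1) ↪ Fin N, ∑ _b ∈ W, m ^ (N - (k + 1)) :=
          card_biUnion_le.trans (sum_le_sum fun φ _ => card_biUnion_le.trans
            (sum_le_sum fun b _ => card_piFinset_comp_eq M φ b))
      _ = _ := by
          rw [sum_const, sum_const, smul_eq_mul, smul_eq_mul, card_univ]
  have hkN : k + 1 ≤ N := by
    by_contra hlt
    have : E = 0 := by
      rw [hE, Fintype.card_eq_zero_iff]
      exact ⟨fun φ => hlt (by simpa using Fintype.card_le_of_embedding φ)⟩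
    rw [this, zero_mul] at h1
    exact absurd h1 (by simp [hm.ne'])
  have h2 : m ^ (k + 1) ≤ E * #W := by
    have : m ^ (k + 1) * m ^ (N - (k + 1)) ≤ E * #W * m ^ (N - (k + 1)) := by
      rw [← pow_add, Nat.add_sub_cancel' hkN]
      linarith
    exact Nat.le_of_mul_le_mul_right this (by positivity)
  have h3 : #W ≤ #(indepTuples G (k + 1) M) + (k + 1) ^ 2 * m ^ k := by
    refine le_trans (card_le_card ?_) ((card_union_le _ _).trans
      (Nat.add_le_add_left (card_not_injective_le k M) _))
    intro b hb
    simp only [hW, mem_filter, mem_union, mem_indepTuples, Fintype.mem_piFinset, IndepTuple]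
      at hb ⊢
    tauto
  have h4 : 2 * E * (k + 1) ^ 2 * m ^ k ≤ m ^ (k + 1) := by
    rw [pow_succ' m]
    exact Nat.mul_le_mul_right _ (by omega)
  have h5 := Nat.mul_le_mul_left E h3
  nlinarith

end IndependentTuples

section DegreeSum

open Classical in
/-- The neighbours of `v`. -/
noncomputable def nbrs [Fintype V] (G : SimpleGraph V) (v : V) : Finset V := {u | G.Adj v u}

lemma mem_nbrs [Fintype V] {G : SimpleGraph V} {u v : V} : u ∈ nbrs G v ↔ G.Adj v u := by
  simp [nbrs]

lemma card_le_card_of_determined {k r : ℕ} {X : Finset ((Fin k → V) × V)}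
    {C : Finset (Fin r → V)} (e : Fin k → Fin r) (q : Fin r)
    (h : ∀ x ∈ X, ∃ f ∈ C, (∀ i, f (e i) = x.1 i) ∧ f q = x.2) : #X ≤ #C := by
  obtain rfl | ⟨x₀, hx₀⟩ := X.eq_empty_or_nonempty
  · simp
  have : Nonempty (Fin r → V) := ⟨(h x₀ hx₀).choose⟩
  choose! F hF hF₁ hF₂ using h
  refine card_le_card_of_injOn F hF fun x hx y hy hxy => ?_
  refine Prod.ext (funext fun i => ?_) ?_
  · rw [← hF₁ x hx, ← hF₁ y hy, hxy]
  · rw [← hF₂ x hx, ← hF₂ y hy, hxy]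

open Classical in
lemma card_indep_nbr_le [Fintype V] {G : SimpleGraph V} {p m : ℕ} (hG : CommonCliques p G)
    (hm : 1 ≤ m) (hmp : m + 2 ≤ p) :
    #{x : (Fin (m + 1) → V) × V | IndepTuple G x.1 ∧ G.Adj x.2 (x.1 0)} ≤
      2 * #(oddCycles G (m + 1)) := by
  rw [← card_filter_add_card_filter_not (fun x => G.Adj x.2 (x.1 (Fin.last m))), two_mul]
  refine Nat.add_le_add ?_ ?_
  · refine card_le_card_of_determined (fun i => evenPos (i + 1)) (oddPos ⟨0, by omega⟩) ?_
    intro x hx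
    simp only [mem_filter, mem_univ, true_and] at hx
    obtain ⟨⟨hb, h0⟩, hl⟩ := hx
    have hb' : IndepTuple G fun i => x.1 (i - 1) :=
      ⟨fun i j h => by simpa using hb.1 h, fun i j => hb.2 _ _⟩
    obtain ⟨f, hf, hf₁, hf₂⟩ := hb'.exists_oddCycle_one (z := x.2) hG (by omega) (by omega)
      (by
        convert hl using 2
        ext
        simp)
      (by
        convert h0 using 2
        ext
        have : 1 % (m + 1) = 1 := Nat.mod_eq_of_lt (by omega)
        simp [Fin.sub_def, this])
    exact ⟨f, hf, fun i => by rw [hf₁]; simp, hf₂⟩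
  · refine card_le_card_of_determined evenPos (oddPos (Fin.last _)) ?_
    intro x hx
    simp only [mem_filter, mem_univ, true_and] at hx
    exact hx.1.1.exists_oddCycle_last hG (by omega) (by omega) hx.1.2 hx.2

lemma indepTuple_cons {k : ℕ} {G : SimpleGraph V} {v : V} {b : Fin k → V}
    (hb : IndepTuple G b) (hv : ∀ i, b i ≠ v ∧ ¬ G.Adj v (b i)) :
    IndepTuple G (Fin.cons v b : Fin (k + 1) → V) := by
  refine ⟨Fin.cons_injective_iff.2 ⟨fun ⟨i, hi⟩ => (hv i).1 hi, hb.1⟩, fun i j => ?_⟩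
  refine Fin.cases ?_ (fun i => ?_) i <;> refine Fin.cases ?_ (fun j => ?_) j
  · exact G.irrefl
  · exact (hv j).2
  · exact fun h => (hv i).2 h.symm
  · exact hb.2 i j

/-- In a graph with few labelled cycles of length `2 * m + 3`, the degree sum is small. -/
lemma exists_degree_sum_mul_le (s p m : ℕ) (hm : 1 ≤ m) (hmp : m + 2 ≤ p) :
    ∃ K n₀ : ℕ, ∀ {V : Type} [Fintype V] (G : SimpleGraph V), G.CliqueFree s →
      CommonCliques p G → n₀ ≤ Fintype.card V →
      (∑ v, #(nbrs G v)) * Fintype.card V ^ m ≤ K * #(oddCycles G (m + 1)) := by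
  classical
  obtain ⟨K₁, m₁, h₁⟩ := exists_pow_le_mul_card_indepTuples s m
  obtain ⟨K₂, m₂, h₂⟩ := exists_pow_le_mul_card_indepTuples s (m + 1)
  refine ⟨3 ^ m * K₁ * 2 + 2 ^ m * K₂, 3 * m₁ + 2 * m₂ + 6, fun {V} _ G hfree hG hn => ?_⟩
  set n := Fintype.card V
  set X : Finset ((Fin (m + 1) → V) × V) :=
    {x : (Fin (m + 1) → V) × V | IndepTuple G x.1 ∧ G.Adj x.2 (x.1 0)}
  set Y : Finset ((Fin (m + 1) → V) × V) :=
    {x : (Fin (m + 1) → V) × V | IndepTuple G x.1 ∧ ∀ i, G.Adj x.2 (x.1 i)}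
  have hX : #X ≤ 2 * #(oddCycles G (m + 1)) := card_indep_nbr_le hG hm hmp
  have hY : #Y ≤ #(oddCycles G (m + 1)) := by
    refine card_le_card_of_determined evenPos (oddPos ⟨0, by omega⟩) ?_
    intro x hx
    simp only [Y, mem_filter, mem_univ, true_and] at hx
    exact hx.1.exists_oddCycle_one hG (by omega) (by omega) (hx.2 _) (hx.2 _)
  have hXs : #X = ∑ v, #{x ∈ X | x.1 0 = v} :=
    card_eq_sum_card_fiberwise (fun _ _ => mem_coe.2 (mem_univ _))
  have hYs : #Y = ∑ v, #{x ∈ Y | x.2 = v} :=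
    card_eq_sum_card_fiberwise (fun _ _ => mem_coe.2 (mem_univ _))
  have key : ∀ v, #(nbrs G v) * n ^ m ≤
      3 ^ m * K₁ * #{x ∈ X | x.1 0 = v} + 2 ^ m * K₂ * #{x ∈ Y | x.2 = v} := by
    intro v
    obtain hv | hv := le_or_gt (2 * #(nbrs G v)) n
    · refine le_trans ?_ (Nat.le_add_right _ _)
      set M : Finset V := (univ \ nbrs G v).erase v
      have hM : n ≤ 3 * #M := by
        have e1 : #(univ \ nbrs G v) = n - #(nbrs G v) := by
          rw [card_sdiff_of_subset (subset_univ _), card_univ]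
        have e2 : #(univ \ nbrs G v) - 1 ≤ #M := pred_card_le_card_erase
        omega
      have hd := h₁ G M hfree (by omega)
      have hfib : #(nbrs G v) * #(indepTuples G m M) ≤ #{x ∈ X | x.1 0 = v} := by
        rw [← card_product]
        refine card_le_card_of_injOn (fun y => (Fin.cons v y.2, y.1)) ?_ ?_
        · rintro ⟨z, b⟩ hzb
          simp only [coe_product, Set.mem_prod, mem_coe, mem_nbrs, mem_indepTuples] at hzb
          simp only [X, coe_filter, mem_filter, mem_univ, true_and, Set.mem_ofPred_eq,
            Fin.cons_zero, and_true]
          refine ⟨indepTuple_cons hzb.2.2 fun i => ?_, hzb.1.symm⟩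
          have := hzb.2.1 i
          simp only [M, mem_erase, mem_sdiff, mem_univ, true_and, mem_nbrs] at this
          exact this
        · rintro ⟨z, b⟩ _ ⟨z', b'⟩ _ h
          simp only [Prod.mk.injEq, Fin.cons_inj] at h
          simp [h.1.2, h.2]
      calc #(nbrs G v) * n ^ m ≤ #(nbrs G v) * (3 * #M) ^ m := by gcongr
        _ = 3 ^ m * (#(nbrs G v) * #M ^ m) := by rw [mul_pow]; ring
        _ ≤ 3 ^ m * (#(nbrs G v) * (K₁ * #(indepTuples G m M))) := by gcongr
        _ = 3 ^ m * K₁ * (#(nbrs G v) * #(indepTuples G m M)) := by ring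
        _ ≤ _ := by gcongr
    · refine le_trans ?_ (Nat.le_add_left _ _)
      have hd := h₂ G (nbrs G v) hfree (by omega)
      have hfib : #(indepTuples G (m + 1) (nbrs G v)) ≤ #{x ∈ Y | x.2 = v} := by
        refine card_le_card_of_injOn (fun b => (b, v)) ?_ ?_
        · intro b hb
          simp only [mem_coe, mem_indepTuples, mem_nbrs] at hb
          simp only [Y, coe_filter, mem_filter, mem_univ, true_and, Set.mem_ofPred_eq, and_true]
          exact ⟨hb.2, hb.1⟩
        · intro b _ b' _ h
          exact (Prod.mk.inj h).1
      calc #(nbrs G v) * n ^ m ≤ #(nbrs G v) * (2 * #(nbrs G v)) ^ m := by gcongr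
        _ = 2 ^ m * #(nbrs G v) ^ (m + 1) := by rw [mul_pow, pow_succ]; ring
        _ ≤ 2 ^ m * (K₂ * #(indepTuples G (m + 1) (nbrs G v))) := by gcongr
        _ = 2 ^ m * K₂ * #(indepTuples G (m + 1) (nbrs G v)) := by ring
        _ ≤ _ := by gcongr
  calc (∑ v, #(nbrs G v)) * n ^ m = ∑ v, #(nbrs G v) * n ^ m := by rw [sum_mul]
    _ ≤ ∑ v, (3 ^ m * K₁ * #{x ∈ X | x.1 0 = v} + 2 ^ m * K₂ * #{x ∈ Y | x.2 = v}) :=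
        sum_le_sum fun v _ => key v
    _ = 3 ^ m * K₁ * #X + 2 ^ m * K₂ * #Y := by
        rw [sum_add_distrib, ← mul_sum, ← mul_sum, ← hXs, ← hYs]
    _ ≤ 3 ^ m * K₁ * (2 * #(oddCycles G (m + 1))) + 2 ^ m * K₂ * #(oddCycles G (m + 1)) := by
        gcongr
    _ = _ := by ring

end DegreeSum

section Join

/-- The join of the complete graph on `T` with the edgeless graph on the complement of `T`. -/
def joinOn (T : Finset V) : SimpleGraph V := SimpleGraph.fromRel fun a _ => a ∈ T

lemma joinOn_adj {T : Finset V} {a b : V} : (joinOn T).Adj a b ↔ a ≠ b ∧ (a ∈ T ∨ b ∈ T) := by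
  simp [joinOn]

open Classical in
/-- The positions at which `f` takes values outside `T`. -/
noncomputable def outside {r : ℕ} (T : Finset V) (f : Fin r → V) : Finset (Fin r) := {j | f j ∉ T}

lemma mem_outside {r : ℕ} {T : Finset V} {f : Fin r → V} {j : Fin r} :
    j ∈ outside T f ↔ f j ∉ T := by
  simp [outside]

variable [Fintype V] {k : ℕ}

lemma mem_or_mem_of_mem_oddCycles_joinOn {T : Finset V} {f : Fin (2 * k + 1) → V}
    (hf : f ∈ oddCycles (joinOn T) k) (j : Fin (2 * k + 1)) : f j ∈ T ∨ f (j + 1) ∈ T :=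
  (joinOn_adj.1 ((mem_oddCycles.1 hf).2 j)).2

lemma disjoint_outside {T : Finset V} {f : Fin (2 * k + 1) → V}
    (hf : f ∈ oddCycles (joinOn T) k) :
    Disjoint (outside T f) ((outside T f).map (Equiv.subRight 1).toEmbedding) := by
  rw [Finset.disjoint_left]
  intro j hj hj'
  simp only [mem_map, mem_outside, Equiv.coe_toEmbedding, Equiv.subRight_apply] at hj hj'
  obtain ⟨i, hi, rfl⟩ := hj'
  have := mem_or_mem_of_mem_oddCycles_joinOn hf (i - 1)
  rw [sub_add_cancel] at this
  tauto

lemma card_outside_le {T : Finset V} {f : Fin (2 * k + 1) → V}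
    (hf : f ∈ oddCycles (joinOn T) k) : #(outside T f) ≤ k := by
  classical
  have h := card_union_of_disjoint (disjoint_outside hf)
  have h' := card_le_univ (outside T f ∪ (outside T f).map (Equiv.subRight 1).toEmbedding)
  rw [card_map] at h
  rw [Fintype.card_fin] at h'
  omega

open Classical in
lemma card_oddCycles_joinOn_meeting_le (T R : Finset V) (hTR : Disjoint T R) :
    #{f ∈ oddCycles (joinOn T) k | ∃ j, f j ∈ R} ≤
      2 ^ (2 * k + 1) * (2 * k + 1) * (#T + 1) ^ (2 * k) * #R * Fintype.card V ^ (k - 1) := by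
  obtain hR | ⟨v, -⟩ := R.eq_empty_or_nonempty
  · simp [hR]
  have hn : 0 < Fintype.card V := Fintype.card_pos_iff.2 ⟨v⟩
  set n := Fintype.card V
  have hsub : {f ∈ oddCycles (joinOn T) k | ∃ j, f j ∈ R} ⊆
      (univ.filter fun Q : Finset (Fin (2 * k + 1)) => #Q ≤ k).biUnion fun Q => Q.biUnion fun q =>
        Fintype.piFinset fun i => if i = q then R else if i ∈ Q then univ else T := by
    intro f hf
    obtain ⟨hf, j, hj⟩ := mem_filter.1 hf
    have hjT : f j ∉ T := fun h => Finset.disjoint_left.1 hTR h hj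
    simp only [mem_biUnion, mem_filter, mem_univ, true_and, Fintype.mem_piFinset]
    refine ⟨outside T f, card_outside_le hf, j, mem_outside.2 hjT, fun i => ?_⟩
    split_ifs with h₁ h₂
    · rwa [h₁]
    · exact mem_univ _
    · simpa [mem_outside] using h₂
  have hpi : ∀ Q : Finset (Fin (2 * k + 1)), #Q ≤ k → ∀ q ∈ Q,
      #(Fintype.piFinset fun i => if i = q then R else if i ∈ Q then univ else T) ≤
        #R * (n ^ (k - 1) * (#T + 1) ^ (2 * k)) := by
    intro Q hQ q hq
    rw [Fintype.card_piFinset, ← mul_prod_erase _ _ (mem_univ q)]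
    simp only [if_true]
    refine Nat.mul_le_mul_left _ ?_
    calc _ ≤ ∏ i ∈ univ.erase q, ((if i ∈ Q then n else 1) * (#T + 1)) := by
          refine prod_le_prod' fun i hi => ?_
          rw [if_neg (ne_of_mem_erase hi)]
          split_ifs
          · rw [card_univ]
            exact Nat.le_mul_of_pos_right _ (Nat.succ_pos _)
          · omega
      _ = n ^ (#Q - 1) * (#T + 1) ^ (2 * k) := by
          rw [prod_mul_distrib, prod_const, card_erase_of_mem (mem_univ _), card_univ,
            Fintype.card_fin, Nat.add_sub_cancel, prod_ite, prod_const_one, mul_one, prod_const]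
          congr 2
          rw [← card_erase_of_mem hq]
          congr 1
          ext i
          simp
      _ ≤ _ := Nat.mul_le_mul_right _ (Nat.pow_le_pow_right hn (by omega))
  calc _ ≤ _ := card_le_card hsub
    _ ≤ ∑ Q : Finset (Fin (2 * k + 1)) with #Q ≤ k, ∑ _q ∈ Q,
          #R * (n ^ (k - 1) * (#T + 1) ^ (2 * k)) :=
        card_biUnion_le.trans (sum_le_sum fun Q hQ => card_biUnion_le.trans
          (sum_le_sum fun q hq => hpi Q (mem_filter.1 hQ).2 q hq))
    _ ≤ ∑ _Q : Finset (Fin (2 * k + 1)),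
          (2 * k + 1) * (#R * (n ^ (k - 1) * (#T + 1) ^ (2 * k))) := by
        refine (sum_le_sum_of_subset (filter_subset _ _)).trans (sum_le_sum fun Q _ => ?_)
        rw [sum_const, smul_eq_mul]
        exact Nat.mul_le_mul_right _ (by simpa using card_le_univ Q)
    _ = _ := by
        rw [sum_const, card_univ, Fintype.card_finset, Fintype.card_fin, smul_eq_mul]
        ring

open Classical in
lemma card_oddCycles_joinOn_sparse_le (T : Finset V) (hn : 0 < Fintype.card V) :
    #{f ∈ oddCycles (joinOn T) k | #(outside T f) ≤ k - 1} ≤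
      2 ^ (2 * k + 1) * (#T + 1) ^ (2 * k + 1) * Fintype.card V ^ (k - 1) := by
  set n := Fintype.card V
  have hsub : {f ∈ oddCycles (joinOn T) k | #(outside T f) ≤ k - 1} ⊆
      (univ.filter fun Q : Finset (Fin (2 * k + 1)) => #Q ≤ k - 1).biUnion fun Q =>
        Fintype.piFinset fun i => if i ∈ Q then univ else T := by
    intro f hf
    obtain ⟨hf, hj⟩ := mem_filter.1 hf
    simp only [mem_biUnion, mem_filter, mem_univ, true_and, Fintype.mem_piFinset]
    refine ⟨outside T f, hj, fun i => ?_⟩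
    split_ifs with h₂
    · exact mem_univ _
    · simpa [mem_outside] using h₂
  have hpi : ∀ Q : Finset (Fin (2 * k + 1)), #Q ≤ k - 1 →
      #(Fintype.piFinset fun i => if i ∈ Q then univ else T) ≤
        n ^ (k - 1) * (#T + 1) ^ (2 * k + 1) := by
    intro Q hQ
    rw [Fintype.card_piFinset]
    calc _ ≤ ∏ i : Fin (2 * k + 1), ((if i ∈ Q then n else 1) * (#T + 1)) := by
          refine prod_le_prod' fun i hi => ?_
          split_ifs
          · rw [card_univ]
            exact Nat.le_mul_of_pos_right _ (Nat.succ_pos _)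
          · omega
      _ = n ^ #Q * (#T + 1) ^ (2 * k + 1) := by
          rw [prod_mul_distrib, prod_const, card_univ, Fintype.card_fin, prod_ite,
            prod_const_one, mul_one, prod_const]
          simp
      _ ≤ _ := Nat.mul_le_mul_right _ (Nat.pow_le_pow_right hn hQ)
  calc _ ≤ _ := card_le_card hsub
    _ ≤ ∑ Q : Finset (Fin (2 * k + 1)) with #Q ≤ k - 1, n ^ (k - 1) * (#T + 1) ^ (2 * k + 1) :=
        card_biUnion_le.trans (sum_le_sum fun Q hQ => hpi Q (mem_filter.1 hQ).2)
    _ ≤ ∑ _Q : Finset (Fin (2 * k + 1)), n ^ (k - 1) * (#T + 1) ^ (2 * k + 1) :=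
        sum_le_sum_of_subset (filter_subset _ _)
    _ = _ := by
        rw [sum_const, card_univ, Fintype.card_finset, Fintype.card_fin, smul_eq_mul]
        ring

open Fin.CommRing in
/-- A labelled cycle with `k` vertices outside `T` alternates, up to rotation. -/
lemma exists_rotation_of_card_outside {T : Finset V} {f : Fin (2 * k + 1) → V}
    (hf : f ∈ oddCycles (joinOn T) k) (hk : #(outside T f) = k) :
    ∃ z, (∀ i, f (evenPos i + z) ∉ T) ∧ ∀ i, f (oddPos i + z) ∈ T := by
  classical
  have h := card_union_of_disjoint (disjoint_outside hf)
  rw [card_map, hk] at h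
  have hc : #(univ \ (outside T f ∪ (outside T f).map (Equiv.subRight 1).toEmbedding)) = 1 := by
    rw [card_sdiff_of_subset (subset_univ _), h, card_univ, Fintype.card_fin]
    omega
  obtain ⟨z, hz⟩ := card_eq_one.1 hc
  have hz' : ∀ y, (f y ∈ T ∧ f (y + 1) ∈ T) ↔ y = z := by
    intro y
    rw [← mem_singleton, ← hz]
    simp only [mem_sdiff, mem_univ, true_and, mem_union, mem_map, mem_outside,
      Equiv.coe_toEmbedding, Equiv.subRight_apply, not_or, not_not, not_exists, not_and]
    refine and_congr_right fun _ => ⟨fun h x hx hxy => hx ?_, fun h => ?_⟩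
    · rw [← hxy, sub_add_cancel] at h
      exact h
    · by_contra hy
      exact h _ hy (add_sub_cancel_right _ _)
  have hg : ∀ i : ℕ, i ≤ 2 * k → (f ((i : Fin (2 * k + 1)) + (z + 1)) ∈ T ↔ i % 2 = 0) := by
    intro i
    induction i with
    | zero =>
      intro _
      simpa using ((hz' z).2 rfl).2
    | succ i ih =>
      intro hi
      have ih := ih (by omega)
      have e : ((i + 1 : ℕ) : Fin (2 * k + 1)) + (z + 1) =
          (i : Fin (2 * k + 1)) + (z + 1) + 1 := by
        push_cast
        ring
      have h1 := mem_or_mem_of_mem_oddCycles_joinOn hf ((i : Fin (2 * k + 1)) + (z + 1))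
      have h2 := hz' ((i : Fin (2 * k + 1)) + (z + 1))
      have h3 : (i : Fin (2 * k + 1)) + (z + 1) ≠ z := by
        intro h
        have h4 : ((i + 1 : ℕ) : Fin (2 * k + 1)) = 0 := by
          have : (i : Fin (2 * k + 1)) + 1 + z = 0 + z := by
            rw [zero_add]
            nth_rewrite 2 [← h]
            ring
          push_cast
          exact add_right_cancel this
        have h5 := congrArg Fin.val h4
        rw [Fin.val_natCast, Nat.mod_eq_of_lt (by omega)] at h5
        simp at h5
      rw [e]
      have : (i + 1) % 2 = 0 ↔ ¬ i % 2 = 0 := by omega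
      tauto
  have hpos : ∀ j : Fin (2 * k + 1), j + (z + 2) =
      (((j : ℕ) + 1 : ℕ) : Fin (2 * k + 1)) + (z + 1) := by
    intro j
    push_cast
    ring
  refine ⟨z + 2, fun i => ?_, fun i => ?_⟩
  · rw [hpos, hg _ (by simp only [evenPos]; omega)]
    simp only [evenPos]
    omega
  · rw [hpos]
    by_cases hi : (i : ℕ) < k
    · rw [hg _ (by simp only [oddPos, hi, if_true]; omega)]
      simp only [oddPos, hi, if_true]
      omega
    · have : (((oddPos i : Fin (2 * k + 1)) : ℕ) + 1 : ℕ) = 2 * k + 1 := by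
        simp [oddPos, hi]
      rw [this]
      simpa using ((hz' z).2 rfl).2

open Classical in
lemma card_oddCycles_joinOn_dense_le (T : Finset V) :
    #{f ∈ oddCycles (joinOn T) k | #(outside T f) = k} ≤
      (2 * k + 1) * (Fintype.card V ^ k * (#T).descFactorial (k + 1)) := by
  set X : Fin (2 * k + 1) → Finset (Fin (2 * k + 1) → V) := fun z =>
    {f | Function.Injective f ∧ ∀ i, f (oddPos i + z) ∈ T}
  have hX : ∀ z, #(X z) ≤ Fintype.card V ^ k * (#T).descFactorial (k + 1) := by
    intro z
    have hc : Fintype.card V ^ k * (#T).descFactorial (k + 1) =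
        #((univ : Finset (Fin k → V)) ×ˢ sdrs fun _ : Fin (k + 1) => T) := by
      simp [card_product, card_sdrs_const]
    rw [hc]
    refine card_le_card_of_injOn (fun f => (fun i => f (evenPos i + z), fun i => f (oddPos i + z)))
      ?_ ?_
    · intro f hf
      simp only [X, coe_filter, mem_univ, true_and, Set.mem_ofPred_eq] at hf
      simp only [coe_product, Set.mem_prod, mem_coe, mem_univ, true_and, mem_sdrs]
      exact ⟨hf.2, fun i j h => oddPos_injective (by simpa using hf.1 h)⟩
    · intro f _ g _ h
      simp only [Prod.mk.injEq] at h
      funext j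
      rw [← sub_add_cancel j z]
      rcases evenPos_or_oddPos (j - z) with ⟨i, hi⟩ | ⟨i, hi⟩ <;> rw [hi]
      · exact congrFun h.1 i
      · exact congrFun h.2 i
  calc _ ≤ #(univ.biUnion X) := by
        refine card_le_card fun f hf => ?_
        obtain ⟨hf, hk⟩ := mem_filter.1 hf
        obtain ⟨z, -, hz⟩ := exists_rotation_of_card_outside hf hk
        simp only [X, mem_biUnion, mem_filter, mem_univ, true_and]
        exact ⟨z, (mem_oddCycles.1 hf).1, hz⟩
    _ ≤ ∑ _z : Fin (2 * k + 1), Fintype.card V ^ k * (#T).descFactorial (k + 1) :=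
        card_biUnion_le.trans (sum_le_sum fun z _ => hX z)
    _ = _ := by simp

lemma card_oddCycles_joinOn_le (T : Finset V) (hn : 0 < Fintype.card V) :
    #(oddCycles (joinOn T) k) ≤
      (2 * k + 1) * (Fintype.card V ^ k * (#T).descFactorial (k + 1)) +
      2 ^ (2 * k + 1) * (#T + 1) ^ (2 * k + 1) * Fintype.card V ^ (k - 1) := by
  classical
  rw [← card_filter_add_card_filter_not (fun f => #(outside T f) = k)]
  refine Nat.add_le_add (card_oddCycles_joinOn_dense_le T) ?_
  refine le_trans (card_le_card fun f hf => ?_) (card_oddCycles_joinOn_sparse_le T hn)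
  rw [mem_filter] at hf ⊢
  have := card_outside_le hf.1
  exact ⟨hf.1, by omega⟩

end Join

section Patterns

variable {G : SimpleGraph V} {k p : ℕ} {H : Finset V}

/-- Nonadjacent vertices outside `H` with all their common neighbours in `H`. -/
def GoodPair (G : SimpleGraph V) (H : Finset V) (u v : V) : Prop :=
  u ≠ v ∧ ¬ G.Adj u v ∧ u ∉ H ∧ v ∉ H ∧ ∀ t, G.Adj u t → G.Adj v t → t ∈ H

lemma exists_cliques_of_goodPairs (hG : CommonCliques p G) (hk : 2 ≤ k) {b : Fin k → V}
    (hb : ∀ i j, i ≠ j → GoodPair G H (b i) (b j)) :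
    ∃ S : Fin (k + 1) → Finset V, (∀ i, G.IsNClique p (S i)) ∧
      (∀ i (hi : i + 1 < k), ∀ t ∈ S ⟨i, by omega⟩,
        G.Adj (b ⟨i, by omega⟩) t ∧ G.Adj (b ⟨i + 1, hi⟩) t) ∧
      (∀ t ∈ S (Fin.last k), G.Adj (b ⟨k - 1, by omega⟩) t ∧ G.Adj (b ⟨0, by omega⟩) t) ∧
      S ⟨k - 1, by omega⟩ = S (Fin.last k) := by
  have key : ∀ u v : Fin k, u ≠ v → ∃ S : Finset V, G.IsNClique p S ∧
      ∀ t ∈ S, G.Adj (b u) t ∧ G.Adj (b v) t :=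
    fun u v huv => hG _ _ (hb u v huv).1 (hb u v huv).2.1
  choose! S hS hS' using key
  have h0 : (⟨k - 1, by omega⟩ : Fin k) ≠ ⟨0, by omega⟩ := by
    simp only [ne_eq, Fin.ext_iff]
    omega
  refine ⟨fun i => if h : (i : ℕ) + 1 < k then S ⟨i, by omega⟩ ⟨i + 1, h⟩
    else S ⟨k - 1, by omega⟩ ⟨0, by omega⟩, fun i => ?_, fun i hi t ht => ?_, fun t ht => ?_, ?_⟩
  · dsimp only
    split_ifs with h
    · exact hS _ _ (by simp [Fin.ext_iff])
    · exact hS _ _ h0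
  · simp only [hi, dite_true] at ht
    exact hS' _ _ (by simp [Fin.ext_iff]) _ ht
  · simp only [Fin.val_last, show ¬ k + 1 < k by omega, dite_false] at ht
    exact hS' _ _ h0 _ ht
  · simp only [Fin.val_last, show ¬ k + 1 < k by omega, show ¬ k - 1 + 1 < k by omega, dite_false]

variable [Fintype V]

open Classical in
/-- The labelled cycles of length `2 * k + 1` whose vertices at the positions `oddPos` are those
lying in `H`. -/
noncomputable def patCycles (G : SimpleGraph V) (k : ℕ) (H : Finset V) :
    Finset (Fin (2 * k + 1) → V) :=
  {f ∈ oddCycles G k | (∀ i, f (evenPos i) ∉ H) ∧ ∀ i, f (oddPos i) ∈ H}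

lemma mem_patCycles {f : Fin (2 * k + 1) → V} : f ∈ patCycles G k H ↔
    f ∈ oddCycles G k ∧ (∀ i, f (evenPos i) ∉ H) ∧ ∀ i, f (oddPos i) ∈ H := by
  simp [patCycles]

lemma eq_of_mem_patCycles (hk : 0 < k) {f : Fin (2 * k + 1) → V} (hf : f ∈ patCycles G k H)
    {x : Fin (2 * k + 1)} (hx : f x ∈ H) (hx' : f (x + 1) ∈ H) :
    x = oddPos ⟨k - 1, by omega⟩ := by
  obtain ⟨-, he, -⟩ := mem_patCycles.1 hf
  rcases evenPos_or_oddPos x with ⟨i, rfl⟩ | ⟨i, rfl⟩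
  · exact absurd hx (he i)
  · obtain hi | hi := (Nat.le_of_lt_succ i.2).lt_or_eq
    · obtain hi' | hi' := (Nat.succ_le_of_lt hi).lt_or_eq
      · rw [oddPos_add_one hi'] at hx'
        exact absurd hx' (he _)
      · congr 1
        ext
        simp only
        omega
    · rw [show i = Fin.last k from Fin.ext hi, oddPos_last_add_one hk] at hx'
      exact absurd hx' (he _)

/-- Different rotations of the cycles in `patCycles` are different. -/
lemma mul_card_patCycles_le (hk : 0 < k) :
    (2 * k + 1) * #(patCycles G k H) ≤ #(oddCycles G k) := by
  classical
  have hc : (2 * k + 1) * #(patCycles G k H) =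
      #((univ : Finset (Fin (2 * k + 1))) ×ˢ patCycles G k H) := by
    simp [card_product]
  rw [hc]
  refine card_le_card_of_injOn (fun x j => x.2 (j + x.1)) ?_ ?_
  · rintro ⟨z, f⟩ hf
    simp only [coe_product, Set.mem_prod, mem_coe, mem_univ, true_and] at hf
    have hf' := mem_oddCycles.1 (mem_patCycles.1 hf).1
    simp only [mem_coe, mem_oddCycles]
    refine ⟨fun i j hij => add_right_cancel (hf'.1 hij), fun j => ?_⟩
    have := hf'.2 (j + z)
    rwa [add_right_comm] at this
  · rintro ⟨z, f⟩ hf ⟨w, g⟩ hg h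
    simp only [coe_product, Set.mem_prod, mem_coe, mem_univ, true_and] at hf hg
    have h' : ∀ j, f j = g (j + (w - z)) := by
      intro j
      have := congrFun h (j - z)
      simp only [sub_add_cancel] at this
      rw [this]
      congr 1
      abel
    have ho := (mem_patCycles.1 hf).2.2
    have h1 := ho ⟨k - 1, by omega⟩
    have h2 := ho (Fin.last k)
    rw [← oddPos_pred_last_add_one (i := ⟨k - 1, by omega⟩) (by simp only; omega)] at h2
    rw [h'] at h1 h2
    rw [add_right_comm] at h2
    have := eq_of_mem_patCycles hk hg h1 h2
    have hwz : w - z = 0 := by simpa using this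
    have : w = z := sub_eq_zero.1 hwz
    subst this
    have : f = g := by
      funext j
      simpa using h' j
    rw [this]

open Classical in
/-- The cycles in `patCycles` through the tuple `b`. -/
noncomputable def patCyclesThrough (G : SimpleGraph V) {k : ℕ} (H : Finset V) (b : Fin k → V) :
    Finset (Fin (2 * k + 1) → V) :=
  {f ∈ patCycles G k H | ∀ i, f (evenPos i) = b i}

lemma card_sdrs_le_card_patCyclesThrough [DecidableEq V] (hk : 2 ≤ k) {b : Fin k → V}
    (hb : ∀ i j, i ≠ j → GoodPair G H (b i) (b j)) {S : Fin (k + 1) → Finset V}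
    (h₁ : ∀ i (hi : i + 1 < k), ∀ t ∈ S ⟨i, by omega⟩,
      G.Adj (b ⟨i, by omega⟩) t ∧ G.Adj (b ⟨i + 1, hi⟩) t)
    (h₂ : ∀ t ∈ S (Fin.last k), G.Adj (b ⟨k - 1, by omega⟩) t ∧ G.Adj (b ⟨0, by omega⟩) t)
    (h₃ : S ⟨k - 1, by omega⟩ = S (Fin.last k)) (h₄ : G.IsClique (S (Fin.last k))) :
    #(sdrs S) ≤ #(patCyclesThrough G H b) := by
  have hbinj : Function.Injective b := by
    intro i j hij
    by_contra h
    exact (hb i j h).1 hij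
  have hbH : ∀ i, b i ∉ H := by
    intro i
    obtain ⟨j, hj⟩ : ∃ j : Fin k, j ≠ i := by
      by_cases h : (i : ℕ) = 0
      · exact ⟨⟨1, by omega⟩, by simp [Fin.ext_iff, h]⟩
      · exact ⟨⟨0, by omega⟩, by simp only [ne_eq, Fin.ext_iff]; omega⟩
    exact (hb i j hj.symm).2.2.1
  refine card_le_card_of_injOn (fun t => weave b t) ?_ ?_
  · intro t ht
    obtain ⟨htS, htinj⟩ := mem_sdrs.1 (mem_coe.1 ht)
    have hlast := h₂ _ (htS (Fin.last k))
    have hpred : t ⟨k - 1, by omega⟩ ∈ S (Fin.last k) := h₃ ▸ htS ⟨k - 1, by omega⟩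
    have htH : ∀ i, t i ∈ H := by
      intro i
      by_cases hi : (i : ℕ) + 1 < k
      · have := h₁ i hi (t i) (htS i)
        exact (hb ⟨i, by omega⟩ ⟨i + 1, hi⟩ (by simp [Fin.ext_iff])).2.2.2.2 _ this.1 this.2
      · have : t i ∈ S (Fin.last k) := by
          by_cases hi' : (i : ℕ) = k
          · rw [← show i = Fin.last k from Fin.ext hi']
            exact htS i
          · rw [← h₃, show (⟨k - 1, by omega⟩ : Fin (k + 1)) = i from
              Fin.ext (by simp only; omega)]
            exact htS i
        have := h₂ _ this
        exact (hb ⟨k - 1, by omega⟩ ⟨0, by omega⟩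
          (by simp only [ne_eq, Fin.ext_iff]; omega)).2.2.2.2 _ this.1 this.2
    have hmem : weave b t ∈ oddCycles G k := by
      refine weave_mem_oddCycles (by omega) hbinj htinj
        (fun i j h => hbH i (h ▸ htH j)) ?_ ?_ ?_ hlast.2.symm
      · intro i hi
        by_cases hi' : i + 1 < k
        · exact (h₁ i hi' _ (htS _)).1
        · have : i = k - 1 := by omega
          subst this
          exact (h₂ _ hpred).1
      · intro i hi
        exact (h₁ i hi _ (htS _)).2.symm
      · refine h₄ (mem_coe.2 hpred) (mem_coe.2 (htS _)) fun h => ?_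
        have := htinj h
        simp only [Fin.ext_iff, Fin.val_last] at this
        omega
    simp only [patCyclesThrough, coe_filter, Set.mem_ofPred_eq, mem_patCycles, weave_evenPos,
      weave_oddPos]
    exact ⟨⟨hmem, hbH, htH⟩, fun _ => trivial⟩
  · intro t _ t' _ h
    funext i
    have := congrFun h (oddPos i)
    simpa only [weave_oddPos] using this

lemma descFactorial_le_card_patCyclesThrough (hG : CommonCliques p G) (hkp : k + 1 ≤ p)
    (hk : 2 ≤ k) {b : Fin k → V} (hb : ∀ i j, i ≠ j → GoodPair G H (b i) (b j)) :
    p.descFactorial (k + 1) ≤ #(patCyclesThrough G H b) := by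
  classical
  obtain ⟨S, hS, h₁, h₂, h₃⟩ := exists_cliques_of_goodPairs hG hk hb
  exact (descFactorial_le_card_sdrs S hkp fun i => (hS i).2.ge).trans
    (card_sdrs_le_card_patCyclesThrough hk hb h₁ h₂ h₃ (hS _).1)

lemma descFactorial_lt_card_patCyclesThrough (hG : CommonCliques p G) (hkp : k + 1 ≤ p)
    (hk : 3 ≤ k) {b : Fin k → V} (hb : ∀ i j, i ≠ j → GoodPair G H (b i) (b j))
    {Q Q' : Finset V} (hQ : G.IsNClique p Q) (hQ' : G.IsNClique p Q') (hne : Q ≠ Q')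
    (hQb : ∀ t ∈ Q, G.Adj (b ⟨0, by omega⟩) t ∧ G.Adj (b ⟨1, by omega⟩) t)
    (hQb' : ∀ t ∈ Q', G.Adj (b ⟨1, by omega⟩) t ∧ G.Adj (b ⟨2, by omega⟩) t) :
    p.descFactorial (k + 1) < #(patCyclesThrough G H b) := by
  classical
  obtain ⟨S, hS, h₁, h₂, h₃⟩ := exists_cliques_of_goodPairs hG (by omega) hb
  obtain ⟨x, hx, hx'⟩ : ∃ x ∈ Q, x ∉ Q' := by
    by_contra! h
    exact hne (eq_of_subset_of_card_le h (by rw [hQ.2, hQ'.2]))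
  let S' : Fin (k + 1) → Finset V := fun i =>
    if (i : ℕ) = 0 then Q else if (i : ℕ) = 1 then Q' else S i
  have hS' : ∀ i, p ≤ #(S' i) := by
    intro i
    simp only [S']
    split_ifs
    exacts [hQ.2.ge, hQ'.2.ge, (hS i).2.ge]
  have e₀ : ∀ i : Fin (k + 1), (i : ℕ) = 0 → S' i = Q := fun i hi => if_pos hi
  have e₁ : ∀ i : Fin (k + 1), (i : ℕ) = 1 → S' i = Q' := fun i hi => by
    simp only [S']
    rw [if_neg (by omega), if_pos hi]
  have e₂ : ∀ i : Fin (k + 1), 2 ≤ (i : ℕ) → S' i = S i := fun i hi => by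
    simp only [S']
    rw [if_neg (by omega), if_neg (by omega)]
  have hlast : S' (Fin.last k) = S (Fin.last k) := e₂ _ (by rw [Fin.val_last]; omega)
  refine lt_of_lt_of_le ?_ (card_sdrs_le_card_patCyclesThrough (S := S') (by omega) hb ?_ ?_ ?_ ?_)
  · obtain ⟨k, rfl⟩ : ∃ m, k = m + 1 := ⟨k - 1, by omega⟩
    refine descFactorial_lt_card_sdrs S' hkp hS' (x := x) ?_ ?_
    · rwa [e₀ 0 rfl]
    · rwa [e₁ 1 (by simp)]
  · intro i hi t ht
    match i with
    | 0 => exact hQb t (by rwa [e₀ _ rfl] at ht)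
    | 1 => exact hQb' t (by rwa [e₁ _ rfl] at ht)
    | i + 2 => exact h₁ (i + 2) hi t (by rwa [e₂ _ (by simp)] at ht)
  · rwa [hlast]
  · rw [hlast, e₂ _ (by simp only; omega), h₃]
  · rw [hlast]
    exact (hS _).1

end Patterns

section Stability

variable [Fintype V] {G : SimpleGraph V} {k p : ℕ}

open Classical in
/-- The pairs which are not good. -/
noncomputable def badPairs (G : SimpleGraph V) (H : Finset V) : Finset (V × V) :=
  {q | ¬ GoodPair G H q.1 q.2}

open Classical in
lemma card_badPairs_le (G : SimpleGraph V) (H : Finset V) :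
    #(badPairs G H) ≤ Fintype.card V + ∑ v, #(nbrs G v) + 2 * (#H * Fintype.card V) +
      ∑ t with t ∉ H, #(nbrs G t) * #(nbrs G t) := by
  classical
  have hsub : badPairs G H ⊆ (((univ.image fun v : V => (v, v)) ∪
      ((univ : Finset V).biUnion fun v => (nbrs G v).image fun u => (v, u))) ∪
      (H ×ˢ univ ∪ univ ×ˢ H)) ∪
      ((univ.filter fun t => t ∉ H).biUnion fun t => nbrs G t ×ˢ nbrs G t) := by
    rintro ⟨u, v⟩ huv
    replace huv : ¬ GoodPair G H u v := (mem_filter.1 huv).2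
    by_cases h₁ : u = v
    · subst h₁
      simp
    by_cases h₂ : G.Adj u v
    · simp [mem_nbrs, h₂]
    by_cases h₃ : u ∈ H
    · simp [h₃]
    by_cases h₄ : v ∈ H
    · simp [h₄]
    obtain ⟨t, htu, htv, htH⟩ : ∃ t, G.Adj u t ∧ G.Adj v t ∧ t ∉ H := by
      by_contra! h
      exact huv ⟨h₁, h₂, h₃, h₄, h⟩
    refine mem_union_right _ (mem_biUnion.2 ⟨t, by simpa using htH, ?_⟩)
    simp [mem_nbrs, htu.symm, htv.symm]
  refine (card_le_card hsub).trans ((card_union_le _ _).trans (Nat.add_le_add ?_ ?_))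
  · refine (card_union_le _ _).trans (Nat.add_le_add ?_ ?_)
    · refine (card_union_le _ _).trans (Nat.add_le_add ?_ ?_)
      · exact card_image_le
      · exact card_biUnion_le.trans (sum_le_sum fun v _ => card_image_le)
    · refine (card_union_le _ _).trans ?_
      rw [card_product, card_product, card_univ]
      linarith
  · exact card_biUnion_le.trans (sum_le_sum fun t _ => (card_product _ _).le)

open Classical in
/-- The vertices of degree at least `n / D`. -/
noncomputable def highDegree (G : SimpleGraph V) (D : ℕ) : Finset V :=
  {v | Fintype.card V ≤ D * #(nbrs G v)}

lemma card_highDegree_le {C D : ℕ} (hn : 0 < Fintype.card V)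
    (hC : ∑ v, #(nbrs G v) ≤ C * Fintype.card V) : #(highDegree G D) ≤ D * C := by
  classical
  refine Nat.le_of_mul_le_mul_right ?_ hn
  calc #(highDegree G D) * Fintype.card V = ∑ _v ∈ highDegree G D, Fintype.card V := by simp
    _ ≤ ∑ v ∈ highDegree G D, D * #(nbrs G v) := sum_le_sum fun v hv => (mem_filter.1 hv).2
    _ ≤ ∑ v, D * #(nbrs G v) := sum_le_sum_of_subset (subset_univ _)
    _ = D * ∑ v, #(nbrs G v) := (mul_sum _ _ _).symm
    _ ≤ D * (C * Fintype.card V) := Nat.mul_le_mul_left _ hC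
    _ = _ := (mul_assoc _ _ _).symm

lemma mul_card_badPairs_le {C D : ℕ} (hn : 0 < Fintype.card V)
    (hC : ∑ v, #(nbrs G v) ≤ C * Fintype.card V)
    (hD : D + D * C + 2 * D * (D * C) ≤ Fintype.card V) :
    D * #(badPairs G (highDegree G D)) ≤ (C + 1) * Fintype.card V ^ 2 := by
  classical
  set n := Fintype.card V with hnn
  have h₁ := card_badPairs_le G (highDegree G D)
  have h₂ : #(highDegree G D) ≤ D * C := card_highDegree_le hn hC
  have h₃ : D * ∑ t with t ∉ highDegree G D, #(nbrs G t) * #(nbrs G t) ≤ n * (C * n) := by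
    calc _ = ∑ t with t ∉ highDegree G D, D * #(nbrs G t) * #(nbrs G t) := by
          rw [mul_sum]
          exact sum_congr rfl fun t _ => (mul_assoc _ _ _).symm
      _ ≤ ∑ t with t ∉ highDegree G D, n * #(nbrs G t) := by
          refine sum_le_sum fun t ht => Nat.mul_le_mul_right _ ?_
          simp only [highDegree, mem_filter, mem_univ, true_and, not_le] at ht
          exact ht.le
      _ ≤ ∑ t, n * #(nbrs G t) := sum_le_sum_of_subset (subset_univ _)
      _ = n * ∑ t, #(nbrs G t) := (mul_sum _ _ _).symm
      _ ≤ _ := Nat.mul_le_mul_left _ hC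
  calc D * #(badPairs G (highDegree G D))
      ≤ D * (n + ∑ v, #(nbrs G v) + 2 * (#(highDegree G D) * n) +
          ∑ t with t ∉ highDegree G D, #(nbrs G t) * #(nbrs G t)) := Nat.mul_le_mul_left _ h₁
    _ = D * n + D * ∑ v, #(nbrs G v) + 2 * D * #(highDegree G D) * n +
          D * ∑ t with t ∉ highDegree G D, #(nbrs G t) * #(nbrs G t) := by ring
    _ ≤ D * n + D * (C * n) + 2 * D * (D * C) * n + n * (C * n) := by gcongr
    _ = (D + D * C + 2 * D * (D * C)) * n + n * (C * n) := by ring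
    _ ≤ n * n + n * (C * n) := by gcongr
    _ = _ := by ring

open Classical in
lemma card_tuples_through_le (P : Finset (V × V)) {i j : Fin k} (hij : i ≠ j) :
    #{b : Fin k → V | (b i, b j) ∈ P} ≤ #P * Fintype.card V ^ (k - 2) := by
  have hsub : (univ.filter fun b : Fin k → V => (b i, b j) ∈ P) ⊆ P.biUnion fun q =>
      Fintype.piFinset fun l => if l = i then {q.1} else if l = j then {q.2} else univ := by
    intro b hb
    simp only [mem_filter, mem_univ, true_and] at hb
    simp only [mem_biUnion, Fintype.mem_piFinset]
    refine ⟨_, hb, fun l => ?_⟩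
    split_ifs with h₁ h₂ <;> simp [*]
  refine (card_le_card hsub).trans (card_biUnion_le.trans ?_)
  rw [← smul_eq_mul, ← sum_const]
  refine sum_le_sum fun q _ => ?_
  rw [Fintype.card_piFinset, ← mul_prod_erase _ _ (mem_univ i),
    ← mul_prod_erase _ _ (mem_erase.2 ⟨hij.symm, mem_univ j⟩)]
  simp only [if_true, if_neg hij.symm, card_singleton, one_mul]
  rw [prod_congr rfl (g := fun _ => Fintype.card V)]
  · rw [prod_const, card_erase_of_mem (mem_erase.2 ⟨hij.symm, mem_univ j⟩),
      card_erase_of_mem (mem_univ i), card_univ, Fintype.card_fin]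
    rfl
  · intro l hl
    simp only [mem_erase, mem_univ, and_true] at hl
    rw [if_neg hl.2, if_neg hl.1, card_univ]

open Classical in
/-- The tuples of pairwise good vertices. -/
noncomputable def goodTuples (G : SimpleGraph V) (k : ℕ) (H : Finset V) : Finset (Fin k → V) :=
  {b | ∀ i j, i ≠ j → GoodPair G H (b i) (b j)}

lemma mem_goodTuples {H : Finset V} {b : Fin k → V} :
    b ∈ goodTuples G k H ↔ ∀ i j, i ≠ j → GoodPair G H (b i) (b j) := by
  simp [goodTuples]

open Classical in
lemma card_compl_goodTuples_le (H : Finset V) :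
    #(goodTuples G k H)ᶜ ≤ k ^ 2 * (#(badPairs G H) * Fintype.card V ^ (k - 2)) := by
  have hsub : (goodTuples G k H)ᶜ ⊆
      (univ.filter fun q : Fin k × Fin k => q.1 ≠ q.2).biUnion fun q =>
        {b : Fin k → V | (b q.1, b q.2) ∈ badPairs G H} := by
    intro b hb
    simp only [mem_compl, mem_goodTuples, not_forall] at hb
    obtain ⟨i, j, hij, h⟩ := hb
    simp only [mem_biUnion, mem_filter, mem_univ, true_and, Prod.exists, badPairs]
    exact ⟨i, j, hij, h⟩
  refine (card_le_card hsub).trans (card_biUnion_le.trans ?_)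
  calc _ ≤ ∑ _q : Fin k × Fin k with _q.1 ≠ _q.2,
          #(badPairs G H) * Fintype.card V ^ (k - 2) :=
        sum_le_sum fun q hq => card_tuples_through_le _ (mem_filter.1 hq).2
    _ ≤ ∑ _q : Fin k × Fin k, #(badPairs G H) * Fintype.card V ^ (k - 2) :=
        sum_le_sum_of_subset (filter_subset _ _)
    _ = _ := by simp [sq]

open Classical in
/-- The good tuples lying in at most `d` cycles of `patCycles`. -/
noncomputable def perfectTuples (G : SimpleGraph V) (k : ℕ) (H : Finset V) (d : ℕ) :
    Finset (Fin k → V) :=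
  {b ∈ goodTuples G k H | #(patCyclesThrough G H b) ≤ d}

lemma mem_perfectTuples {H : Finset V} {d : ℕ} {b : Fin k → V} :
    b ∈ perfectTuples G k H d ↔
      (∀ i j, i ≠ j → GoodPair G H (b i) (b j)) ∧ #(patCyclesThrough G H b) ≤ d := by
  simp [perfectTuples, mem_goodTuples]

lemma card_goodTuples_le (hG : CommonCliques p G) (hkp : k + 1 ≤ p) (hk : 2 ≤ k) (H : Finset V) :
    #(goodTuples G k H) * (p.descFactorial (k + 1) + 1) ≤
      #(patCycles G k H) + #(perfectTuples G k H (p.descFactorial (k + 1))) := by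
  classical
  have h₁ : ∑ b ∈ goodTuples G k H, #(patCyclesThrough G H b) ≤ #(patCycles G k H) := by
    rw [← card_biUnion]
    · refine card_le_card fun f hf => ?_
      obtain ⟨b, -, hb⟩ := mem_biUnion.1 hf
      exact (mem_filter.1 hb).1
    · intro b _ b' _ hbb'
      rw [Function.onFun, Finset.disjoint_left]
      intro f hf hf'
      refine hbb' (funext fun i => ?_)
      rw [← (mem_filter.1 hf).2 i, (mem_filter.1 hf').2 i]
  have h₂ : #(perfectTuples G k H (p.descFactorial (k + 1))) = ∑ b ∈ goodTuples G k H,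
      if #(patCyclesThrough G H b) ≤ p.descFactorial (k + 1) then 1 else 0 := by
    rw [perfectTuples, card_filter]
  rw [h₂, ← smul_eq_mul, ← sum_const]
  refine le_trans ?_ (Nat.add_le_add_right h₁ _)
  rw [← sum_add_distrib]
  refine sum_le_sum fun b hb => ?_
  have := descFactorial_le_card_patCyclesThrough hG hkp hk (mem_goodTuples.1 hb)
  split_ifs <;> omega

open Classical in
lemma card_compl_perfectTuples_le (hG : CommonCliques p G) (hkp : k + 1 ≤ p) (hk : 2 ≤ k)
    (H : Finset V) {E : ℕ} (hE : #(oddCycles G k) ≤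
      (2 * k + 1) * (Fintype.card V ^ k * p.descFactorial (k + 1)) + E) :
    #(perfectTuples G k H (p.descFactorial (k + 1)))ᶜ ≤
      #(goodTuples G k H)ᶜ * (p.descFactorial (k + 1) + 1) + E := by
  have h₁ := card_goodTuples_le hG hkp hk H
  have h₂ := (mul_card_patCycles_le (G := G) (H := H) (by omega)).trans hE
  have h₃ := card_add_card_compl (goodTuples G k H)
  have h₄ := card_add_card_compl (perfectTuples G k H (p.descFactorial (k + 1)))
  rw [Fintype.card_fun, Fintype.card_fin] at h₃ h₄
  set d := p.descFactorial (k + 1)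
  have h₅ : #(patCycles G k H) ≤ Fintype.card V ^ k * d + E := by
    refine Nat.le_of_mul_le_mul_left (h₂.trans ?_) (show 0 < 2 * k + 1 by omega)
    rw [mul_add]
    exact Nat.add_le_add_left (Nat.le_mul_of_pos_left _ (by omega)) _
  have h₆ := congrArg (· * (d + 1)) h₃
  simp only [add_mul] at h₆
  rw [mul_add, mul_one] at h₆
  nlinarith

lemma exists_tail_of_card_le {m C D : ℕ} (N : Finset (Fin (m + 1) → V)) (hn : 0 < Fintype.card V)
    (hN : D * #N ≤ C * Fintype.card V ^ (m + 1)) :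
    ∃ b : Fin m → V, ∀ X : Finset V, (∀ v ∈ X, (Fin.cons v b : Fin (m + 1) → V) ∈ N) →
      D * #X ≤ C * Fintype.card V := by
  classical
  by_contra! h
  choose X hX hX' using h
  have hcard : ∑ b, #(X b) ≤ #N := by
    rw [← card_sigma]
    refine card_le_card_of_injOn (fun x => (Fin.cons x.2 x.1 : Fin (m + 1) → V)) ?_ ?_
    · rintro ⟨b, v⟩ hv
      simp only [coe_sigma, Set.mem_sigma_iff, mem_coe, mem_univ, true_and] at hv
      exact hX b v hv
    · rintro ⟨b, v⟩ _ ⟨b', v'⟩ _ h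
      obtain ⟨rfl, rfl⟩ := Fin.cons_inj.1 h
      rfl
  have : Nonempty V := Fintype.card_pos_iff.1 hn
  have hlt : ∑ _b : Fin m → V, C * Fintype.card V < ∑ b, D * #(X b) :=
    sum_lt_sum_of_nonempty univ_nonempty fun b _ => hX' b
  rw [sum_const, card_univ, Fintype.card_fun, Fintype.card_fin, smul_eq_mul,
    ← mul_sum] at hlt
  have h2 := Nat.mul_le_mul_left D hcard
  have h3 : C * Fintype.card V ^ (m + 1) = Fintype.card V ^ m * (C * Fintype.card V) := by ring
  linarith

open Classical in
/-- The vertices which are not adjacent to all of `T`. -/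
noncomputable def deficient (G : SimpleGraph V) (T : Finset V) : Finset V :=
  {v | ∃ t ∈ T, ¬ G.Adj v t}

lemma mem_deficient {T : Finset V} {v : V} : v ∈ deficient G T ↔ ∃ t ∈ T, ¬ G.Adj v t := by
  simp [deficient]

end Stability

/-- A `K_s`-free graph with common cliques and with at most as many odd cycles as the join has a
clique which is complete to almost all vertices. -/
lemma exists_clique_almost_complete (s p k M : ℕ) (hk : 3 ≤ k) (hkp : k + 1 ≤ p) :
    ∃ n₀, ∀ {V : Type} [Fintype V] (G : SimpleGraph V), G.CliqueFree s → CommonCliques p G →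
      n₀ ≤ Fintype.card V → ∀ T : Finset V, #T = p →
      #(oddCycles G k) ≤ #(oddCycles (joinOn T) k) →
      ∃ S, G.IsNClique p S ∧ M * #(deficient G S) ≤ Fintype.card V := by
  classical
  obtain ⟨K, n₁, hK⟩ := exists_degree_sum_mul_le s p (k - 1) (by omega) (by omega)
  set d := p.descFactorial (k + 1) with hd
  set E := 2 ^ (2 * k + 1) * (p + 1) ^ (2 * k + 1)
  set C := K * ((2 * k + 1) * d + E)
  set C' := k ^ 2 * (C + 1) * (d + 1) + 1
  set D := (M + 2) * (C' + 1)
  refine ⟨n₁ + (D + D * C + 2 * D * (D * C)) + D * E + 1, fun {V} _ G hs hG hn T hT hle => ?_⟩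
  set n := Fintype.card V
  have hn0 : 0 < n := by omega
  have hle' : #(oddCycles G k) ≤ (2 * k + 1) * (n ^ k * d) + E * n ^ (k - 1) := by
    have := card_oddCycles_joinOn_le (k := k) T hn0
    rw [hT] at this
    exact hle.trans this
  have hpow : n ^ k = n * n ^ (k - 1) := by
    rw [← pow_succ']
    congr 1
    omega
  have hpow' : n ^ k = n ^ 2 * n ^ (k - 2) := by
    rw [← pow_add]
    congr 1
    omega
  have hC : ∑ v, #(nbrs G v) ≤ C * n := by
    have h₁ := hK G hs hG (by omega)
    rw [show k - 1 + 1 = k by omega] at h₁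
    refine Nat.le_of_mul_le_mul_right (h₁.trans ?_) (Nat.pow_pos (n := k - 1) hn0)
    calc K * #(oddCycles G k) ≤ K * ((2 * k + 1) * (n ^ k * d) + E * n ^ k) := by
          refine Nat.mul_le_mul_left _ (hle'.trans ?_)
          gcongr
          omega
      _ = C * n * n ^ (k - 1) := by
          rw [hpow]
          ring
  set H := highDegree G D
  have hbad : D * #(badPairs G H) ≤ (C + 1) * n ^ 2 := mul_card_badPairs_le hn0 hC (by omega)
  have hN : D * #(perfectTuples G k H d)ᶜ ≤ C' * n ^ k := by
    have h₁ := card_compl_perfectTuples_le hG hkp (by omega) H hle'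
    have h₂ := card_compl_goodTuples_le (G := G) (k := k) H
    calc D * #(perfectTuples G k H d)ᶜ
        ≤ D * (k ^ 2 * (#(badPairs G H) * n ^ (k - 2)) * (d + 1) + E * n ^ (k - 1)) :=
          Nat.mul_le_mul_left _ (h₁.trans (by gcongr))
      _ = k ^ 2 * (D * #(badPairs G H)) * n ^ (k - 2) * (d + 1) + D * E * n ^ (k - 1) := by ring
      _ ≤ k ^ 2 * ((C + 1) * n ^ 2) * n ^ (k - 2) * (d + 1) + n * n ^ (k - 1) := by
          gcongr
          omega
      _ = k ^ 2 * (C + 1) * (d + 1) * (n ^ 2 * n ^ (k - 2)) + n * n ^ (k - 1) := by ring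
      _ = C' * n ^ k := by
          rw [← hpow, ← hpow']
          ring
  obtain ⟨m, rfl⟩ : ∃ m, k = m + 1 := ⟨k - 1, by omega⟩
  obtain ⟨b, hb⟩ := exists_tail_of_card_le _ hn0 hN
  set X : Finset V := {v | (Fin.cons v b : Fin (m + 1) → V) ∈ (perfectTuples G (m + 1) H d)ᶜ}
  have hX : D * #X ≤ C' * n := hb X fun v hv => (mem_filter.1 hv).2
  have hX' : (M + 2) * #X ≤ n := by
    refine Nat.le_of_mul_le_mul_left (c := C' + 1) ?_ (by omega)
    calc (C' + 1) * ((M + 2) * #X) = D * #X := by ring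
      _ ≤ C' * n := hX
      _ ≤ _ := Nat.mul_le_mul_right _ (by omega)
  have hperf : ∀ v, v ∉ X → (Fin.cons v b : Fin (m + 1) → V) ∈ perfectTuples G (m + 1) H d := by
    intro v hv
    simpa [X] using hv
  obtain ⟨v₀, hv₀⟩ : ∃ v₀, v₀ ∉ X := by
    by_contra! h
    have : #X = n := by rw [eq_univ_of_forall h, card_univ]
    nlinarith
  have hgood : GoodPair G H (b ⟨0, by omega⟩) (b ⟨1, by omega⟩) := by
    have := (mem_perfectTuples.1 (hperf v₀ hv₀)).1 (Fin.succ ⟨0, by omega⟩)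
      (Fin.succ ⟨1, by omega⟩) (by simp [Fin.ext_iff])
    simpa only [Fin.cons_succ] using this
  obtain ⟨S, hS, hSb⟩ := hG _ _ hgood.1 hgood.2.1
  refine ⟨S, hS, le_trans (Nat.mul_le_mul (by omega) (card_le_card ?_)) hX'⟩
  intro v hv
  obtain ⟨t, ht, hvt⟩ := mem_deficient.1 hv
  by_contra hvX
  obtain ⟨hpg, hpd⟩ := mem_perfectTuples.1 (hperf v hvX)
  have hg : GoodPair G H v (b ⟨0, by omega⟩) := by
    have := hpg 0 (Fin.succ ⟨0, by omega⟩) (Fin.succ_ne_zero _).symm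
    simpa only [Fin.cons_succ, Fin.cons_zero] using this
  obtain ⟨Q, hQ, hQb⟩ := hG _ _ hg.1 hg.2.1
  have hne : Q ≠ S := by
    rintro rfl
    exact hvt (hQb t ht).1
  refine absurd hpd (not_le.2 ?_)
  exact descFactorial_lt_card_patCyclesThrough hG hkp hk hpg hQ hS hne hQb hSb

section NearJoin

variable [Fintype V] {G : SimpleGraph V} {p k : ℕ} {T : Finset V}

lemma adj_of_notMem_deficient {v t : V} (hv : v ∉ deficient G T) (ht : t ∈ T) : G.Adj v t := by
  by_contra h
  exact hv (mem_deficient.2 ⟨t, ht, h⟩)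

lemma not_adj_of_notMem_deficient (hG : G.CliqueFree (p + 2)) (hT : G.IsNClique p T) {a b : V}
    (ha : a ∉ deficient G T) (hb : b ∉ deficient G T) : ¬ G.Adj a b := by
  classical
  intro hab
  refine hG _ ((hT.insert (a := b) fun t ht => adj_of_notMem_deficient hb ht).insert (a := a) ?_)
  intro t ht
  obtain rfl | ht := mem_insert.1 ht
  · exact hab
  · exact adj_of_notMem_deficient ha ht

open Classical in
/-- The vertices outside `T` which are not adjacent to all of `T`. -/
noncomputable def exceptional (G : SimpleGraph V) (T : Finset V) : Finset V := deficient G T \ T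

lemma mem_exceptional {v : V} : v ∈ exceptional G T ↔ v ∈ deficient G T ∧ v ∉ T := by
  simp [exceptional]

lemma adj_iff_joinOn_adj (hG : G.CliqueFree (p + 2)) (hT : G.IsNClique p T) {a b : V}
    (ha : a ∉ exceptional G T) (hb : b ∉ exceptional G T) : G.Adj a b ↔ (joinOn T).Adj a b := by
  rw [joinOn_adj]
  rw [mem_exceptional] at ha hb
  by_cases ha' : a ∈ T <;> by_cases hb' : b ∈ T
  · exact ⟨fun h => ⟨h.ne, Or.inl ha'⟩, fun h => hT.1 ha' hb' h.1⟩
  · have := (adj_of_notMem_deficient (G := G) (fun h => hb ⟨h, hb'⟩) ha').symm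
    exact ⟨fun h => ⟨h.ne, Or.inl ha'⟩, fun _ => this⟩
  · have := adj_of_notMem_deficient (G := G) (fun h => ha ⟨h, ha'⟩) hb'
    exact ⟨fun h => ⟨h.ne, Or.inr hb'⟩, fun _ => this⟩
  · have := not_adj_of_notMem_deficient hG hT (fun h => ha ⟨h, ha'⟩) fun h => hb ⟨h, hb'⟩
    tauto

open Classical in
/-- The labelled cycles meeting `R`. -/
noncomputable def cyclesMeeting (G : SimpleGraph V) (k : ℕ) (R : Finset V) :
    Finset (Fin (2 * k + 1) → V) :=
  {f ∈ oddCycles G k | ∃ j, f j ∈ R}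

lemma mem_cyclesMeeting {R : Finset V} {f : Fin (2 * k + 1) → V} :
    f ∈ cyclesMeeting G k R ↔ f ∈ oddCycles G k ∧ ∃ j, f j ∈ R := by
  simp [cyclesMeeting]

lemma card_oddCycles_joinOn_lt (hG : G.CliqueFree (p + 2)) (hT : G.IsNClique p T)
    (h : #(cyclesMeeting (joinOn T) k (exceptional G T)) < #(cyclesMeeting G k (exceptional G T))) :
    #(oddCycles (joinOn T) k) < #(oddCycles G k) := by
  classical
  rw [← card_filter_add_card_filter_not (s := oddCycles G k)
    (fun f => ∃ j, f j ∈ exceptional G T), ← card_filter_add_card_filter_not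
    (s := oddCycles (joinOn T) k) (fun f => ∃ j, f j ∈ exceptional G T)]
  have heq : {f ∈ oddCycles (joinOn T) k | ¬ ∃ j, f j ∈ exceptional G T} =
      {f ∈ oddCycles G k | ¬ ∃ j, f j ∈ exceptional G T} := by
    ext f
    simp only [mem_filter, mem_oddCycles, not_exists]
    refine and_congr_left fun hf => and_congr_right fun _ => forall_congr' fun j => ?_
    exact (adj_iff_joinOn_adj hG hT (hf _) (hf _)).symm
  rw [heq]
  refine Nat.add_lt_add_right (lt_of_eq_of_lt ?_ (lt_of_lt_of_eq h ?_)) _ <;>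
  · rw [cyclesMeeting]

lemma pow_le_mul_descFactorial {n a c : ℕ} (hc : n ≤ c * a) (ha : 2 * k ≤ a) :
    n ^ k ≤ (2 * c) ^ k * a.descFactorial k := by
  calc n ^ k ≤ (2 * c * (a + 1 - k)) ^ k := by
        refine Nat.pow_le_pow_left (hc.trans ?_) k
        rw [mul_comm 2, mul_assoc]
        exact Nat.mul_le_mul_left _ (by omega)
    _ = (2 * c) ^ k * (a + 1 - k) ^ k := mul_pow _ _ _
    _ ≤ _ := Nat.mul_le_mul_left _ (Nat.pow_sub_le_descFactorial _ _)

/-- Many common neighbours of `T` adjacent to an exceptional vertex give many cycles. -/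
lemma descFactorial_le_card_cyclesMeeting (hG : G.CliqueFree (p + 2)) (hT : G.IsNClique p T)
    (hGp : CommonCliques p G) (hkp : k + 1 ≤ p) (hk : 2 ≤ k) {x : V} (hx : x ∈ exceptional G T)
    {A : Finset V} (hA : ∀ v ∈ A, v ∉ deficient G T ∧ G.Adj x v) :
    (#A).descFactorial k ≤ #(cyclesMeeting G k (exceptional G T)) := by
  classical
  rw [← card_sdrs_const]
  have key : ∀ b ∈ sdrs fun _ : Fin k => A,
      ∃ f ∈ cyclesMeeting G k (exceptional G T), ∀ i, f (evenPos i) = b i := by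
    intro b hb
    obtain ⟨hbA, hbi⟩ := mem_sdrs.1 hb
    obtain ⟨f, hf, hfb, hfx⟩ := IndepTuple.exists_oddCycle_one hGp hkp hk (b := b)
      ⟨hbi, fun i j => not_adj_of_notMem_deficient hG hT (hA _ (hbA i)).1 (hA _ (hbA j)).1⟩
      (hA _ (hbA _)).2 (hA _ (hbA _)).2
    exact ⟨f, mem_cyclesMeeting.2 ⟨hf, _, hfx.symm ▸ hx⟩, hfb⟩
  have : Nonempty (Fin (2 * k + 1) → V) := ⟨fun _ => x⟩
  choose! F hF hF' using key
  refine card_le_card_of_injOn F hF fun b hb b' hb' h => ?_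
  funext i
  rw [← hF' b hb, ← hF' b' hb', h]

/-- Edges between exceptional vertices with few neighbours outside `deficient G T` give many
cycles. -/
lemma mul_descFactorial_le_card_cyclesMeeting (hG : G.CliqueFree (p + 2)) (hT : G.IsNClique p T)
    (hGp : CommonCliques p G) {m L a : ℕ} (hm : 1 ≤ m) (hmp : m + 2 ≤ p)
    (hL : ∀ x ∈ exceptional G T, ∃ Y ⊆ exceptional G T, L ≤ #Y ∧ ∀ y ∈ Y, G.Adj x y)
    (ha : ∀ x ∈ exceptional G T, ∀ y ∈ exceptional G T, ∃ A : Finset V, a ≤ #A ∧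
      ∀ v ∈ A, v ∉ deficient G T ∧ ¬ G.Adj x v ∧ ¬ G.Adj y v) :
    #(exceptional G T) * (L * a.descFactorial m) ≤
      #(cyclesMeeting G (m + 1) (exceptional G T)) := by
  classical
  choose! Y hYR hYL hY using hL
  choose! A hAa hA using ha
  set R := exceptional G T
  let Z : Finset (Σ _ : V, Σ _ : V, Fin m → V) :=
    R.sigma fun x => (Y x).sigma fun y => sdrs fun _ : Fin m => A x y
  have hZ : #R * (L * a.descFactorial m) ≤ #Z := by
    rw [card_sigma, ← smul_eq_mul, ← sum_const]
    refine sum_le_sum fun x hx => ?_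
    rw [card_sigma]
    refine (Nat.mul_le_mul_right _ (hYL x hx)).trans ?_
    rw [← smul_eq_mul, ← sum_const]
    refine sum_le_sum fun y hy => ?_
    rw [card_sdrs_const]
    exact Nat.descFactorial_le _ (hAa x hx y (hYR x hx hy))
  let φ : (Σ _ : V, Σ _ : V, Fin m → V) → (Fin (m + 1) → V) × V :=
    fun w => (Fin.cons w.1 w.2.2, w.2.1)
  have hφ : Function.Injective φ := by
    rintro ⟨x, y, b⟩ ⟨x', y', b'⟩ h
    simp only [φ, Prod.mk.injEq, Fin.cons_inj] at h
    obtain ⟨⟨rfl, rfl⟩, rfl⟩ := h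
    rfl
  rw [← card_image_of_injective Z hφ] at hZ
  refine hZ.trans (card_le_card_of_determined (evenPos (k := m + 1)) (oddPos (Fin.last _)) ?_)
  simp only [mem_image]
  rintro _ ⟨⟨x, y, b⟩, hw, rfl⟩
  simp only [Z, mem_sigma, mem_sdrs] at hw
  obtain ⟨hx, hy, hbA, hbi⟩ := hw
  have hyR := hYR x hx hy
  have hb := fun i => hA x hx y hyR _ (hbA i)
  have hind : IndepTuple G (Fin.cons x b : Fin (m + 1) → V) := by
    refine indepTuple_cons
      ⟨hbi, fun i j => not_adj_of_notMem_deficient hG hT (hb i).1 (hb j).1⟩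
      fun i => ⟨?_, (hb i).2.1⟩
    intro h
    exact (hb i).1 (h ▸ (mem_exceptional.1 hx).1)
  obtain ⟨f, hf, hfe, hfo⟩ := hind.exists_oddCycle_last hGp (z := y) (by omega) (by omega)
    (by
      rw [show (⟨0, by omega⟩ : Fin (m + 1)) = 0 from rfl, Fin.cons_zero]
      exact (hY x hx y hy).symm) (by
      have e : (⟨m + 1 - 1, by omega⟩ : Fin (m + 1)) = Fin.succ ⟨m - 1, by omega⟩ := by
        ext
        simp only [Fin.val_succ]
        omega
      rw [e, Fin.cons_succ]
      exact (hb _).2.2)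
  exact ⟨f, mem_cyclesMeeting.2 ⟨hf, _, hfo.symm ▸ hyR⟩, hfe, hfo⟩

open Classical in
/-- Exceptional vertices with few neighbours outside `deficient G T` have many exceptional
neighbours. -/
lemma card_compl_deficient_le (hG : G.CliqueFree (p + 2)) (hT : G.IsNClique p T)
    (hGp : CommonCliques p G) {x : V} (hx : x ∈ exceptional G T) :
    #(deficient G T)ᶜ ≤ #((deficient G T)ᶜ ∩ nbrs G x) +
      ∑ y ∈ exceptional G T ∩ nbrs G x, #((deficient G T)ᶜ ∩ nbrs G y) := by
  refine (card_le_card (t := ((deficient G T)ᶜ ∩ nbrs G x) ∪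
    (exceptional G T ∩ nbrs G x).biUnion fun y => (deficient G T)ᶜ ∩ nbrs G y) ?_).trans
    ((card_union_le _ _).trans (Nat.add_le_add_left card_biUnion_le _))
  intro b hb
  have hb' := mem_compl.1 hb
  obtain ⟨hxD, hxT⟩ := mem_exceptional.1 hx
  by_cases hxb : G.Adj x b
  · exact mem_union_left _ (mem_inter.2 ⟨hb, mem_nbrs.2 hxb⟩)
  refine mem_union_right _ ?_
  obtain ⟨S, hS, hSa⟩ := hGp x b (fun h => hb' (h ▸ hxD)) hxb
  obtain ⟨y, hyS, hyT⟩ : ∃ y ∈ S, y ∉ T := by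
    by_contra! h
    have hST : S = T := eq_of_subset_of_card_le h (by rw [hS.2, hT.2])
    obtain ⟨t, ht, hxt⟩ := mem_deficient.1 hxD
    exact hxt (hSa t (hST ▸ ht)).1
  have hyD : y ∈ deficient G T := by
    by_contra hyD
    exact not_adj_of_notMem_deficient hG hT hb' hyD (hSa y hyS).2
  exact mem_biUnion.2 ⟨y, mem_inter.2 ⟨mem_exceptional.2 ⟨hyD, hyT⟩, mem_nbrs.2 (hSa y hyS).1⟩,
    mem_inter.2 ⟨hb, mem_nbrs.2 (hSa y hyS).2.symm⟩⟩

end NearJoin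

/-- A graph close to `joinOn T` is `joinOn T` or has more odd cycles. -/
lemma exists_eq_joinOn_or_lt (p k : ℕ) (hk : 2 ≤ k) (hkp : k + 1 ≤ p) :
    ∃ M n₀, ∀ {V : Type*} [Fintype V] (G : SimpleGraph V), G.CliqueFree (p + 2) →
      CommonCliques p G → n₀ ≤ Fintype.card V → ∀ T : Finset V, G.IsNClique p T →
      M * #(deficient G T) ≤ Fintype.card V →
      G = joinOn T ∨ #(oddCycles (joinOn T) k) < #(oddCycles G k) := by
  classical
  obtain ⟨m, rfl⟩ : ∃ m, k = m + 1 := ⟨k - 1, by omega⟩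
  set C := 2 ^ (2 * (m + 1) + 1) * (2 * (m + 1) + 1) * (p + 1) ^ (2 * (m + 1))
  set L := 8 ^ m * C + 1
  set c := 2 * (L + 1) + 8
  set M := C * (2 * c) ^ (m + 1) + 2
  refine ⟨M, 2 * (m + 1) * c + 8 * m + 1, fun {V} _ G hG hGp hn T hT hM => ?_⟩
  set n := Fintype.card V
  set R := exceptional G T with hR
  have hn0 : 0 < n := by omega
  obtain hR0 | ⟨x₀, hx₀⟩ := R.eq_empty_or_nonempty
  · left
    ext a b
    refine adj_iff_joinOn_adj hG hT ?_ ?_ <;>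
    · rw [← hR, hR0]
      exact notMem_empty _
  right
  refine card_oddCycles_joinOn_lt hG hT ?_
  rw [← hR]
  have hRpos : 0 < #R := card_pos.2 ⟨x₀, hx₀⟩
  have hRD : #R ≤ #(deficient G T) := card_le_card fun v hv => (mem_exceptional.1 hv).1
  have hJ : #(cyclesMeeting (joinOn T) (m + 1) R) ≤ C * #R * n ^ m := by
    have hdisj : Disjoint T R :=
      Finset.disjoint_left.2 fun t ht ht' => (mem_exceptional.1 ht').2 ht
    have := card_oddCycles_joinOn_meeting_le (k := m + 1) T R hdisj
    rw [hT.2] at this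
    exact this
  set B := (deficient G T)ᶜ
  have hBn : #(deficient G T) + #B = n := card_add_card_compl _
  have hBn' : n ≤ 2 * #B := by
    have : 2 * #(deficient G T) ≤ n := (Nat.mul_le_mul_right _ (by omega)).trans hM
    omega
  by_cases hcase : ∃ x ∈ R, n ≤ c * #(B ∩ nbrs G x)
  · obtain ⟨x, hx, hxn⟩ := hcase
    have hcyc := descFactorial_le_card_cyclesMeeting hG hT hGp hkp hk hx (A := B ∩ nbrs G x)
      fun v hv => ⟨mem_compl.1 (mem_inter.1 hv).1, mem_nbrs.1 (mem_inter.1 hv).2⟩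
    have hA : 2 * (m + 1) ≤ #(B ∩ nbrs G x) := by
      refine Nat.le_of_mul_le_mul_left (c := c) ?_ (by omega)
      rw [mul_comm]
      omega
    have hpow := pow_le_mul_descFactorial hxn hA
    have h₁ : n ^ (m + 1) ≤ (2 * c) ^ (m + 1) * #(cyclesMeeting G (m + 1) R) :=
      hpow.trans (Nat.mul_le_mul_left _ hcyc)
    have h₂ : M * #(cyclesMeeting (joinOn T) (m + 1) R) ≤
        C * (2 * c) ^ (m + 1) * #(cyclesMeeting G (m + 1) R) := by
      calc _ ≤ M * (C * #R * n ^ m) := Nat.mul_le_mul_left _ hJ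
        _ = C * (M * #R) * n ^ m := by ring
        _ ≤ C * n * n ^ m := by
            gcongr
            exact (Nat.mul_le_mul_left _ hRD).trans hM
        _ = C * n ^ (m + 1) := by ring
        _ ≤ C * ((2 * c) ^ (m + 1) * #(cyclesMeeting G (m + 1) R)) := Nat.mul_le_mul_left _ h₁
        _ = _ := by ring
    have hpos : 0 < #(cyclesMeeting G (m + 1) R) := by
      by_contra! h
      rw [Nat.le_zero.1 h, mul_zero] at h₁
      exact absurd h₁ (not_le.2 (Nat.pow_pos hn0))
    refine Nat.lt_of_mul_lt_mul_left (a := M) (h₂.trans_lt ?_)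
    exact Nat.mul_lt_mul_of_pos_right (by omega) hpos
  · push Not at hcase
    have hL : ∀ x ∈ R, ∃ Y ⊆ R, L ≤ #Y ∧ ∀ y ∈ Y, G.Adj x y := by
      intro x hx
      refine ⟨R ∩ nbrs G x, inter_subset_left, ?_, fun y hy => mem_nbrs.1 (mem_inter.1 hy).2⟩
      have h₁ := card_compl_deficient_le hG hT hGp hx
      have h₂ : c * ∑ y ∈ R ∩ nbrs G x, #(B ∩ nbrs G y) ≤ #(R ∩ nbrs G x) * n := by
        rw [mul_sum, ← smul_eq_mul, ← sum_const]
        exact sum_le_sum fun y hy => (hcase y (mem_inter.1 hy).1).le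
      have h₃ : c * n ≤ 2 * (#(R ∩ nbrs G x) + 1) * n := by
        calc c * n ≤ c * (2 * #B) := Nat.mul_le_mul_left _ hBn'
          _ ≤ c * (2 * (#(B ∩ nbrs G x) + ∑ y ∈ R ∩ nbrs G x, #(B ∩ nbrs G y))) := by
              gcongr
          _ = 2 * (c * #(B ∩ nbrs G x) + c * ∑ y ∈ R ∩ nbrs G x, #(B ∩ nbrs G y)) := by ring
          _ ≤ 2 * (n + #(R ∩ nbrs G x) * n) := by
              have := (hcase x hx).le
              gcongr
          _ = _ := by ring
      have := Nat.le_of_mul_le_mul_right h₃ hn0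
      omega
    have ha : ∀ x ∈ R, ∀ y ∈ R, ∃ A : Finset V, (n + 3) / 4 ≤ #A ∧
        ∀ v ∈ A, v ∉ deficient G T ∧ ¬ G.Adj x v ∧ ¬ G.Adj y v := by
      intro x hx y hy
      refine ⟨B \ (B ∩ nbrs G x ∪ B ∩ nbrs G y), ?_, fun v hv => ?_⟩
      · have h₁ := le_card_sdiff (B ∩ nbrs G x ∪ B ∩ nbrs G y) B
        have h₂ := card_union_le (B ∩ nbrs G x) (B ∩ nbrs G y)
        have h₃ : ∀ z ∈ R, 8 * #(B ∩ nbrs G z) < n := fun z hz =>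
          (Nat.mul_le_mul_right _ (by omega)).trans_lt (hcase z hz)
        have h₄ := h₃ x hx
        have h₅ := h₃ y hy
        omega
      · simp only [mem_sdiff, mem_union, mem_inter, mem_nbrs, not_or, not_and] at hv
        exact ⟨mem_compl.1 hv.1, hv.2.1 hv.1, hv.2.2 hv.1⟩
    have hcyc := mul_descFactorial_le_card_cyclesMeeting (m := m) hG hT hGp (by omega)
      (by omega) hL ha
    have hpow : n ^ m ≤ 8 ^ m * ((n + 3) / 4).descFactorial m := by
      have h₁ : 8 * m + 1 ≤ n := by omega
      have h₂ : n ≤ 4 * ((n + 3) / 4) := by omega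
      have h₃ : 2 * m ≤ (n + 3) / 4 := by omega
      exact pow_le_mul_descFactorial h₂ h₃
    refine Nat.lt_of_mul_lt_mul_left (a := 8 ^ m) ?_
    calc 8 ^ m * #(cyclesMeeting (joinOn T) (m + 1) R) ≤ 8 ^ m * (C * #R * n ^ m) :=
          Nat.mul_le_mul_left _ hJ
      _ = 8 ^ m * C * (#R * n ^ m) := by ring
      _ < L * (#R * n ^ m) :=
          Nat.mul_lt_mul_of_pos_right (Nat.lt_succ_self _) (Nat.mul_pos hRpos (Nat.pow_pos hn0))
      _ ≤ L * (#R * (8 ^ m * ((n + 3) / 4).descFactorial m)) := by gcongr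
      _ = 8 ^ m * (#R * (L * ((n + 3) / 4).descFactorial m)) := by ring
      _ ≤ _ := Nat.mul_le_mul_left _ hcyc

section Counting

variable {α β : Type*} {A : SimpleGraph α} {B : SimpleGraph β}

/-- The copies of `A` with the same image correspond to the automorphisms of `A`. -/
lemma nonempty_fiber_equiv {H : B.Subgraph} (e : H.coe ≃g A) :
    Nonempty ({f : Copy A B // f.toSubgraph = H} ≃ (A ≃g A)) := by
  have hmap : ∀ σ : A ≃g A, (⟨H.hom.comp (SimpleGraph.Iso.toHom (σ.trans e.symm)),
      Subgraph.hom_injective.comp (σ.trans e.symm).injective⟩ : Copy A B).toSubgraph = H := by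
    intro σ
    simp [Copy.toSubgraph, Subgraph.map_comp]
  refine ⟨(Equiv.ofBijective (fun σ : A ≃g A => (⟨_, hmap σ⟩ :
    {f : Copy A B // f.toSubgraph = H})) ⟨fun σ τ h => ?_, ?_⟩).symm⟩
  · ext x
    have := congrArg (fun f : {f : Copy A B // f.toSubgraph = H} => f.1 x) h
    exact e.symm.injective (Subtype.ext this)
  · rintro ⟨f, rfl⟩
    refine ⟨f.isoToSubgraph.trans e, Subtype.ext (DFunLike.ext _ _ fun x => ?_)⟩
    change ((e.symm (e (f.isoToSubgraph x))) : β) = f x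
    rw [RelIso.symm_apply_apply]
    rfl

lemma card_copy_eq (A : SimpleGraph α) (B : SimpleGraph β) : Nat.card (Copy A B) =
    {H : B.Subgraph | Nonempty (H.coe ≃g A)}.ncard * Nat.card (A ≃g A) := by
  let π : Copy A B → {H : B.Subgraph | Nonempty (H.coe ≃g A)} :=
    fun f => ⟨f.toSubgraph, ⟨f.isoToSubgraph.symm⟩⟩
  have hfib : ∀ H : {H : B.Subgraph | Nonempty (H.coe ≃g A)},
      Nonempty ({f : Copy A B // π f = H} ≃ (A ≃g A)) := by
    rintro ⟨H, ⟨e⟩⟩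
    obtain ⟨E⟩ := nonempty_fiber_equiv e
    exact ⟨(Equiv.subtypeEquivRight fun f => by simp [π]).trans E⟩
  rw [Nat.card_congr ((Equiv.sigmaFiberEquiv π).symm.trans
    ((Equiv.sigmaCongrRight fun H => (hfib H).some).trans (Equiv.sigmaEquivProd _ _))),
    Nat.card_prod, Nat.card_coe_set_eq]

lemma card_oddCycles_eq_card_copy [Fintype V] (G : SimpleGraph V) {k : ℕ} (hk : 0 < k) :
    #(oddCycles G k) = Nat.card (Copy (cycleGraph (2 * k + 1)) G) := by
  obtain ⟨m, rfl⟩ : ∃ m, k = m + 1 := ⟨k - 1, by omega⟩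
  have hadj : ∀ u v : Fin (2 * (m + 1) + 1),
      (cycleGraph (2 * (m + 1) + 1)).Adj u v ↔ u = v + 1 ∨ v = u + 1 := by
    intro u v
    refine (cycleGraph_adj (n := 2 * m + 1)).trans ?_
    rw [sub_eq_iff_eq_add', sub_eq_iff_eq_add']
  have h₁ : Nat.card {f // f ∈ oddCycles G (m + 1)} = #(oddCycles G (m + 1)) := by simp
  rw [← h₁]
  refine Nat.card_congr ⟨fun f => ⟨⟨f.1, fun {u v} h => ?_⟩, (mem_oddCycles.1 f.2).1⟩,
    fun f => ⟨f, mem_oddCycles.2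
      ⟨f.injective, fun j => f.toHom.map_adj ((hadj _ _).2 (Or.inr rfl))⟩⟩,
    fun f => rfl, fun f => rfl⟩
  rcases (hadj u v).1 h with rfl | rfl
  · exact ((mem_oddCycles.1 f.2).2 v).symm
  · exact (mem_oddCycles.1 f.2).2 u

lemma card_oddCycles_eq_mul_cycleCount [Fintype V] (G : SimpleGraph V) {k : ℕ} (hk : 0 < k) :
    #(oddCycles G k) = cycleCount G (2 * k + 1) *
      Nat.card (cycleGraph (2 * k + 1) ≃g cycleGraph (2 * k + 1)) := by
  rw [card_oddCycles_eq_card_copy G hk, card_copy_eq, cycleCount]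

lemma card_aut_pos [Finite α] : 0 < Nat.card (A ≃g A) := by
  have : Finite (A ≃g A) := Finite.of_injective (fun e : A ≃g A => (e : α → α))
    DFunLike.coe_injective
  have : Nonempty (A ≃g A) := ⟨RelIso.refl _⟩
  exact Nat.card_pos

lemma card_oddCycles_le_of_iso [Fintype V] {G G' : SimpleGraph V} (e : G ≃g G') (k : ℕ) :
    #(oddCycles G k) ≤ #(oddCycles G' k) := by
  refine card_le_card_of_injOn (fun f j => e (f j)) (fun f hf => ?_) fun f _ g _ h => ?_
  · have hf := mem_oddCycles.1 (mem_coe.1 hf)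
    exact mem_coe.2 (mem_oddCycles.2 ⟨e.injective.comp hf.1, fun j => e.map_adj_iff.2 (hf.2 j)⟩)
  · funext j
    exact e.injective (congrFun h j)

lemma nonempty_joinOn_iso [Fintype V] {S T : Finset V} (h : #S = #T) :
    Nonempty (joinOn S ≃g joinOn T) := by
  classical
  let e : {x // x ∈ S} ≃ {x // x ∈ T} := Finset.equivOfCardEq h
  have hmem : ∀ x, e.extendSubtype x ∈ T ↔ x ∈ S := by
    intro x
    by_cases hx : x ∈ S
    · exact iff_of_true (e.extendSubtype_mem x hx) hx
    · exact iff_of_false (e.extendSubtype_not_mem x hx) hx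
  refine ⟨⟨e.extendSubtype, fun {a b} => ?_⟩⟩
  simp [joinOn_adj, hmem]

lemma exists_joinGraph_eq {n s : ℕ} (hn : s - 2 ≤ n) :
    ∃ T : Finset (Fin n), #T = s - 2 ∧ joinGraph n s = joinOn T := by
  refine ⟨univ.filter fun i : Fin n => (i : ℕ) < s - 2, ?_, ?_⟩
  · rw [Fin.card_filter_val_lt]
    omega
  · ext a b
    simp [joinGraph, joinOn]

end Counting

/-- For `s ≥ 4` and odd `r` with `7 ≤ r ≤ 2s - 4`, for all sufficiently large
`n`, every `K_s`-saturated graph on `n` vertices has at least as many copies of `C_r` as the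
join `K_{s-2} ∗ ∅_{n-s+2}`, and the join is the unique `K_s`-saturated graph attaining this
minimum. -/
theorem cycles_odd_min (s r : ℕ) (hs : 4 ≤ s) (hodd : Odd r) (hr7 : 7 ≤ r)
    (hr : r ≤ 2 * s - 4) :
    ∃ n₀ : ℕ, ∀ n ≥ n₀,
      (∀ G : SimpleGraph (Fin n), KSat s G →
        cycleCount (joinGraph n s) r ≤ cycleCount G r) ∧
      (∀ G : SimpleGraph (Fin n), KSat s G →
        cycleCount G r = cycleCount (joinGraph n s) r → Nonempty (G ≃g joinGraph n s)) := by
  obtain ⟨k, rfl⟩ := hodd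
  obtain ⟨p, rfl⟩ : ∃ p, s = p + 2 := ⟨s - 2, by omega⟩
  obtain ⟨M, n₁, h₁⟩ := exists_eq_joinOn_or_lt p k (by omega) (by omega)
  obtain ⟨n₂, h₂⟩ := exists_clique_almost_complete (p + 2) p k M (by omega) (by omega)
  refine ⟨n₁ + n₂ + p, fun n hn => ?_⟩
  obtain ⟨T, hT, hJ⟩ := exists_joinGraph_eq (n := n) (s := p + 2) (by omega)
  rw [hJ]
  have hcard : Fintype.card (Fin n) = n := Fintype.card_fin n
  have key : ∀ G : SimpleGraph (Fin n), KSat (p + 2) G →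
      Nonempty (G ≃g joinOn T) ∨ #(oddCycles (joinOn T) k) < #(oddCycles G k) := by
    intro G hG
    by_contra! h
    have hGp : CommonCliques p G := hG.commonCliques
    obtain ⟨S, hS, hM⟩ := h₂ G hG.1 hGp (by omega) T hT h.2
    obtain ⟨e⟩ := nonempty_joinOn_iso (hT.trans hS.2.symm : #T = #S)
    rcases h₁ G hG.1 hGp (by omega) S hS hM with rfl | hlt
    · exact absurd ⟨e.symm⟩ (not_nonempty_iff.2 h.1)
    · exact absurd ((card_oddCycles_le_of_iso e k).trans_lt hlt) (not_lt.2 h.2)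
  have hpos := card_aut_pos (A := cycleGraph (2 * k + 1))
  have hcount : ∀ G : SimpleGraph (Fin n), #(oddCycles G k) = cycleCount G (2 * k + 1) * _ :=
    fun G => card_oddCycles_eq_mul_cycleCount G (by omega)
  refine ⟨fun G hG => ?_, fun G hG heq => ?_⟩
  · refine Nat.le_of_mul_le_mul_right ?_ hpos
    rw [← hcount, ← hcount]
    rcases key G hG with e | hlt
    · exact card_oddCycles_le_of_iso e.some.symm k
    · exact hlt.le
  · rcases key G hG with he | hlt
    · exact he
    · rw [hcount, hcount, heq] at hlt
      exact absurd hlt (lt_irrefl _)
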